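/- Let 0 ≤ λ ≤ λ_c. For every m ∈ L¹(𝕋²; S²) and every sequence ε_k → 0 there exists a sequence m_k ∈ H¹(𝕋²; S²) with m_k → m in L¹(𝕋²; ℝ³) and limsup_{k→∞} F_{ε_k,λ}[m_k] ≤ F_{*,λ}[m], where for λ < λ_c, F_{*,λ}[m] := (1 − λ/λ_c) ∫_{𝕋²} |∇m₃| if m ∈ BV(𝕋²; {±e₃}) and +∞ otherwise, and for λ = λ_c, F_{*,λ_c}[m] := 0 if m ∈ L¹(𝕋²; {±e₃}) and +∞ otherwise. -/

import Mathlib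

open MeasureTheory Real Filter

noncomputable section

/-- The plane `ℝ²`, modeled as functions `Fin 2 → ℝ`. -/
abbrev R2 : Type := Fin 2 → ℝ

/-- The target space `ℝ³`. -/
abbrev R3 : Type := Fin 3 → ℝ

/-- A fundamental domain for the unit torus `𝕋² = ℝ²/ℤ²`. -/
def cube : Set R2 := Set.univ.pi fun _ => Set.Ico (0 : ℝ) 1

/-- The Euclidean norm on `ℝ²`. -/
def en2 (z : R2) : ℝ := Real.sqrt (∑ i, z i ^ 2)

/-- The Euclidean norm on `ℝ³`. -/
def en3 (v : R3) : ℝ := Real.sqrt (∑ i, v i ^ 2)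

/-- `|∇f(x)|²` for a scalar function. -/
def gradNormSq (f : R2 → ℝ) (x : R2) : ℝ :=
  ∑ j, (fderiv ℝ f x (Pi.single j 1)) ^ 2

/-- `|∇f(x)|` for a scalar function. -/
def gradNorm (f : R2 → ℝ) (x : R2) : ℝ := Real.sqrt (gradNormSq f x)

/-- `|∇m(x)|²` for a map `m : ℝ² → ℝ³` (Frobenius norm squared). -/
def gradVSq (m : R2 → R3) (x : R2) : ℝ :=
  ∑ j, ∑ i, (fderiv ℝ m x (Pi.single j 1) i) ^ 2

/-- The squared homogeneous `H^{1/2}` seminorm on the torus (real-space formula). -/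
def H12 (f : R2 → ℝ) : ℝ :=
  (1 / (4 * π)) * ∫ x in cube, ∫ z : R2, (f (x + z) - f x) ^ 2 / en2 z ^ 3

/-- A (strong) magnetization in `H¹(𝕋²; S²)`: a continuously differentiable
`ℤ²`-periodic map with values in the unit sphere `S² ⊂ ℝ³`. -/
def Mag (m : R2 → R3) : Prop :=
  ContDiff ℝ 1 m ∧
    (∀ (x : R2) (n : Fin 2 → ℤ), m (x + fun i => (n i : ℝ)) = m x) ∧
    ∀ x, ∑ i, (m x i) ^ 2 = 1

/-- The reduced thin-film energy `F_{ε,λ}`. -/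
def Fen (ε lam : ℝ) (m : R2 → R3) : ℝ :=
  (∫ x in cube, (ε / 2 * gradVSq m x + (1 - (m x 2) ^ 2) / (2 * ε)))
    - lam / |Real.log ε| * H12 (fun x => m x 2)

/-- The north pole `e₃ = (0,0,1)`. -/
def e3 : R3 := ![0, 0, 1]

/-- Admissible test vector fields for the dual definition of the total variation:
smooth `ℤ²`-periodic fields with Euclidean norm at most `1`. -/
def IsAdmField (φ : R2 → R2) : Prop :=
  ContDiff ℝ (⊤ : ℕ∞) φ ∧
    (∀ (x : R2) (n : Fin 2 → ℤ), φ (x + fun i => (n i : ℝ)) = φ x) ∧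
    ∀ x, en2 (φ x) ≤ 1

/-- The set of dual pairings `∫_{𝕋²} u ∇·φ dx` over admissible fields `φ`. -/
def TVset (u : R2 → ℝ) : Set ℝ :=
  {t | ∃ φ : R2 → R2, IsAdmField φ ∧
    t = ∫ x in cube, u x * ∑ i, fderiv ℝ φ x (Pi.single i 1) i}

/-- The total variation `∫_{𝕋²} |∇u|` of a function on the torus. -/
def TV (u : R2 → ℝ) : ℝ := sSup (TVset u)

/-- Membership in `BV(𝕋²; {±e₃})`: `m` takes a.e. only the values `±e₃` and its third
component has finite total variation. -/
def IsBVpm (m : R2 → R3) : Prop :=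
  (∀ᵐ x ∂(volume.restrict cube), m x = e3 ∨ m x = -e3) ∧
    BddAbove (TVset fun x => m x 2)

section Aux

open scoped Pointwise

/-- `ℤ²`-periodic functions. -/
def Per {E : Type*} (f : R2 → E) : Prop :=
  ∀ (x : R2) (n : Fin 2 → ℤ), f (x + fun i => (n i : ℝ)) = f x

lemma measurableSet_cube : MeasurableSet cube :=
  MeasurableSet.univ_pi fun _ => measurableSet_Ico

lemma volume_cube : volume cube = 1 := by
  simp [cube, Real.volume_pi_Ico]

instance : IsProbabilityMeasure (volume.restrict cube) :=
  ⟨by simp [volume_cube]⟩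

lemma cube_subset_Icc : cube ⊆ Set.Icc (0 : R2) 1 := by
  intro x hx
  simp only [cube, Set.mem_pi, Set.mem_univ, true_implies, Set.mem_Ico] at hx
  exact ⟨fun i => (hx i).1, fun i => (hx i).2.le⟩

/-- The fractional part map. -/
def fr (x : R2) : R2 := fun i => Int.fract (x i)

lemma fr_mem (x : R2) : fr x ∈ cube := by
  simp only [cube, Set.mem_pi, Set.mem_univ, true_implies, Set.mem_Ico]
  exact fun i => ⟨Int.fract_nonneg _, Int.fract_lt_one _⟩

lemma fr_eq (x : R2) : fr x = x + fun i => ((-⌊x i⌋ : ℤ) : ℝ) := by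
  ext i; simp [fr, Int.fract, sub_eq_add_neg]

lemma fr_of_mem {x : R2} (hx : x ∈ cube) : fr x = x := by
  simp only [cube, Set.mem_pi, Set.mem_univ, true_implies, Set.mem_Ico] at hx
  ext i; exact Int.fract_eq_self.2 (hx i)

lemma fr_per : Per fr := by
  intro x n; ext i; simp [fr]

lemma measurable_fr : Measurable fr := by
  refine measurable_pi_lambda _ fun i => ?_
  exact measurable_fract.comp (measurable_pi_apply i)

lemma Per.fr_eq {E : Type*} {f : R2 → E} (hf : Per f) (x : R2) : f (fr x) = f x := by
  rw [_root_.fr_eq]; exact hf x (fun i => -⌊x i⌋)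

lemma Per.exists_bound {E : Type*} [NormedAddCommGroup E] {f : R2 → E} (hf : Per f)
    (hc : Continuous f) : ∃ C : ℝ, 0 < C ∧ ∀ x, ‖f x‖ ≤ C := by
  obtain ⟨C, hC⟩ := (isCompact_Icc (a := (0 : R2)) (b := 1)).exists_bound_of_continuousOn
    hc.continuousOn
  refine ⟨max C 1, by positivity, fun x => ?_⟩
  rw [← hf.fr_eq x]
  exact (hC _ (cube_subset_Icc (fr_mem x))).trans (le_max_left _ _)

lemma Per.fderiv {E : Type*} [NormedAddCommGroup E] [NormedSpace ℝ E] {f : R2 → E} (hf : Per f) :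
    Per (fderiv ℝ f) := by
  intro x n
  rw [← fderiv_comp_add_right]
  congr 1
  ext y; exact hf y n

lemma Per.shift {E : Type*} {f : R2 → E} (hf : Per f) (y : R2) : Per (fun x => f (x + y)) := by
  intro x n
  have := hf (x + y) n
  simp only
  rw [← this]; congr 1; abel

lemma cube_eq : cube = ZSpan.fundamentalDomain (Pi.basisFun ℝ (Fin 2)) := by
  ext x
  simp [cube, ZSpan.mem_fundamentalDomain]

lemma integral_shift {E : Type*} [NormedAddCommGroup E] [NormedSpace ℝ E] {f : R2 → E}
    (hf : Per f) (y : R2) : ∫ x in cube, f (x + y) = ∫ x in cube, f x := by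
  have hD := ZSpan.isAddFundamentalDomain' (Pi.basisFun ℝ (Fin 2)) volume
  rw [← cube_eq] at hD
  have hf' : ∀ (g : (Submodule.span ℤ (Set.range (Pi.basisFun ℝ (Fin 2)))).toAddSubgroup) (x : R2),
      f (g +ᵥ x) = f x := by
    rintro ⟨g, hg⟩ x
    have h1 := (Module.Basis.mem_span_iff_repr_mem ℤ (Pi.basisFun ℝ (Fin 2)) g).1 hg
    choose n hn using h1
    have : g = fun i => (n i : ℝ) := by
      ext i; have := hn i; simp at this; exact this.symm
    subst this
    have := hf x n
    rw [← this]
    congr 1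
    exact add_comm _ _
  have hD2 : IsAddFundamentalDomain (Submodule.span ℤ (Set.range (Pi.basisFun ℝ (Fin 2)))).toAddSubgroup
      (y +ᵥ cube) volume := hD.vadd_of_comm y
  have : Countable (Submodule.span ℤ (Set.range (Pi.basisFun ℝ (Fin 2)))).toAddSubgroup :=
    inferInstanceAs (Countable (Submodule.span ℤ (Set.range (Pi.basisFun ℝ (Fin 2)))))
  rw [hD.setIntegral_eq hD2 hf']
  have := (measurePreserving_add_right (volume : Measure R2) y).setIntegral_image_emb
    (measurableEmbedding_addRight y) f cube
  rw [← this]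
  congr 2
  ext z
  simp only [Set.mem_vadd_set, Set.mem_image, vadd_eq_add, add_comm]

lemma integrable_cube {E : Type*} [NormedAddCommGroup E] {f : R2 → E}
    (hf : Continuous f) : IntegrableOn f cube :=
  (hf.continuousOn.integrableOn_compact isCompact_Icc).mono_set cube_subset_Icc

lemma integrable_prod_cube {F : ℝ × R2 → ℝ} (hF : Continuous F) (a b : ℝ) :
    Integrable F ((volume.restrict (Set.Icc a b)).prod (volume.restrict cube)) := by
  rw [Measure.prod_restrict]
  exact (hF.continuousOn.integrableOn_compact (isCompact_Icc.prod isCompact_Icc)).mono_set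
    (Set.prod_mono le_rfl cube_subset_Icc)

lemma integral_deriv_zero {f : R2 → ℝ} (hf : Per f) (hc : ContDiff ℝ 1 f) (e : Fin 2) :
    ∫ x in cube, fderiv ℝ f x (Pi.single e 1) = 0 := by
  have hfc : Continuous (fun x => fderiv ℝ f x (Pi.single e 1)) :=
    (hc.continuous_fderiv one_ne_zero).clm_apply continuous_const
  have hper : Per (fun x => fderiv ℝ f x (Pi.single e 1)) := by
    intro x n; simp only; rw [hf.fderiv x n]
  have h1 : ∀ s : ℝ, ∫ x in cube, fderiv ℝ f (x + s • Pi.single e 1) (Pi.single e 1)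
      = ∫ x in cube, fderiv ℝ f x (Pi.single e 1) := fun s => integral_shift hper _
  have h2 : ∫ s in (0:ℝ)..1, ∫ x in cube, fderiv ℝ f (x + s • Pi.single e 1) (Pi.single e 1)
      = ∫ x in cube, fderiv ℝ f x (Pi.single e 1) := by
    simp [h1]
  rw [← h2, intervalIntegral_integral_swap]
  · have : ∀ x : R2, ∫ s in (0:ℝ)..1, fderiv ℝ f (x + s • Pi.single e 1) (Pi.single e 1) = 0 := by
      intro x
      rw [intervalIntegral.integral_eq_sub_of_hasDerivAt
        (f := fun s : ℝ => f (x + s • Pi.single e 1))]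
      · have := hf x (Pi.single e 1)
        have h3 : (fun i => ((Pi.single e 1 : Fin 2 → ℤ) i : ℝ)) = Pi.single e 1 := by
          ext i; by_cases h : i = e
          · subst h; simp
          · simp [h]
        rw [h3] at this
        simp [this]
      · intro s _
        have h4 : HasDerivAt (fun s : ℝ => x + s • (Pi.single e 1 : R2)) (Pi.single e 1) s := by
          simpa using ((hasDerivAt_id s).smul_const (Pi.single e 1 : R2)).const_add x
        exact ((hc.differentiable one_ne_zero _).hasFDerivAt).comp_hasDerivAt s h4
      · apply Continuous.intervalIntegrable
        exact hfc.comp (by fun_prop)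
    simp [this]
  · rw [Set.uIoc_of_le zero_le_one]
    refine (integrable_prod_cube (F := fun p : ℝ × R2 =>
      fderiv ℝ f (p.2 + p.1 • Pi.single e 1) (Pi.single e 1)) ?_ 0 1).mono_measure ?_
    · exact hfc.comp (by fun_prop)
    · exact Measure.prod_mono (Measure.restrict_mono Set.Ioc_subset_Icc_self le_rfl) le_rfl

/-- A sequence of bump functions. -/
def bmp (n : ℕ) : ContDiffBump (0 : R2) :=
  ⟨1 / ((n : ℝ) + 1), 2 / ((n : ℝ) + 1), by positivity, by
    apply div_lt_div_of_pos_right <;> [norm_num; positivity]⟩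

/-- A sequence of mollifiers. -/
def rho (n : ℕ) : R2 → ℝ := (bmp n).normed volume

/-- Mollification. -/
def moll (n : ℕ) (u : R2 → ℝ) (x : R2) : ℝ := ∫ y, rho n y * u (x - y)

lemma rho_nonneg (n : ℕ) (y : R2) : 0 ≤ rho n y := (bmp n).nonneg_normed y

lemma rho_integral (n : ℕ) : ∫ y, rho n y = 1 := (bmp n).integral_normed

lemma rho_continuous (n : ℕ) : Continuous (rho n) := (bmp n).continuous_normed

lemma rho_integrable (n : ℕ) : Integrable (rho n) := (bmp n).integrable_normed

lemma moll_eq (n : ℕ) (u : R2 → ℝ) :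
    moll n u = convolution (rho n) u (ContinuousLinearMap.lsmul ℝ ℝ) volume := rfl

lemma locInt {u : R2 → ℝ} (hm : Measurable u) {C : ℝ} (hC : ∀ x, |u x| ≤ C) :
    LocallyIntegrable u volume := by
  intro x
  refine ⟨Metric.ball x 1, Metric.ball_mem_nhds x one_pos, ?_⟩
  exact Measure.integrableOn_of_bounded (M := C) measure_ball_lt_top.ne hm.aestronglyMeasurable
    (Eventually.of_forall hC)

lemma moll_contDiff (n : ℕ) {u : R2 → ℝ} (hm : Measurable u) {C : ℝ} (hC : ∀ x, |u x| ≤ C) :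
    ContDiff ℝ (⊤ : ℕ∞) (moll n u) := by
  rw [moll_eq]
  exact (bmp n).hasCompactSupport_normed.contDiff_convolution_left _ (bmp n).contDiff_normed
    (locInt hm hC)

lemma moll_per (n : ℕ) {u : R2 → ℝ} (hp : Per u) : Per (moll n u) := by
  intro x k
  unfold moll
  congr 1; ext y
  rw [← hp (x - y) k]
  congr 2; abel

lemma moll_bound (n : ℕ) {u : R2 → ℝ} {C : ℝ} (hC : ∀ x, |u x| ≤ C)
    (x : R2) : |moll n u x| ≤ C := by
  unfold moll
  rw [← Real.norm_eq_abs]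
  refine (norm_integral_le_of_norm_le ((rho_integrable n).mul_const C) ?_).trans ?_
  · refine Eventually.of_forall fun y => ?_
    rw [norm_mul, Real.norm_eq_abs, abs_of_nonneg (rho_nonneg n y)]
    exact mul_le_mul_of_nonneg_left (hC _) (rho_nonneg n y)
  · rw [integral_mul_const, rho_integral, one_mul]

lemma moll_tendsto {u : R2 → ℝ} (hm : Measurable u) {C : ℝ} (hC : ∀ x, |u x| ≤ C) :
    ∀ᵐ x, Tendsto (fun n => moll n u x) atTop (nhds (u x)) := by
  refine ContDiffBump.ae_convolution_tendsto_right_of_locallyIntegrable (φ := bmp) (K := 2)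
    ?_ ?_ (locInt hm hC)
  · have : Tendsto (fun n : ℕ => 2 * (1 / ((n : ℝ) + 1))) atTop (nhds (2 * 0)) :=
      tendsto_one_div_add_atTop_nhds_zero_nat.const_mul 2
    simpa [bmp, div_eq_mul_inv] using this
  · refine Eventually.of_forall fun n => ?_
    simp [bmp, div_eq_mul_inv]

/-- Duality for the mollification. -/
lemma integral_moll_mul (n : ℕ) {u : R2 → ℝ} (hm : Measurable u) (hp : Per u) {C : ℝ}
    (hC : ∀ x, |u x| ≤ C) {h : R2 → ℝ} (hh : Continuous h) (hhp : Per h) :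
    ∫ x in cube, moll n u x * h x = ∫ y, rho n y * ∫ x in cube, u x * h (x + y) := by
  have h1 : ∀ y, ∫ x in cube, u x * h (x + y) = ∫ x in cube, u (x - y) * h x := by
    intro y
    have := integral_shift (f := fun x => u x * h (x + y)) (fun x k => by
      have := (hhp.shift y) x k; simp only at this ⊢; rw [hp x k, this]) (-y)
    rw [← this]
    simp [sub_eq_add_neg]
  simp_rw [h1]
  unfold moll
  simp_rw [← integral_mul_const, ← integral_const_mul]
  rw [integral_integral_swap]
  · congr 1; ext y; congr 1; ext x; ring
  · obtain ⟨D, hD0, hD⟩ := hhp.exists_bound hh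
    have hmeas : Measurable (fun p : R2 × R2 => rho n p.2 * u (p.1 - p.2) * h p.1) := by
      have := (rho_continuous n).measurable
      have := hh.measurable
      fun_prop
    have hI : Integrable (fun p : R2 × R2 => (1:ℝ) * (rho n p.2 * (C * D)))
        ((volume.restrict cube).prod volume) :=
      (integrable_const (1:ℝ)).mul_prod ((rho_integrable n).mul_const _)
    refine hI.mono' hmeas.aestronglyMeasurable (Eventually.of_forall fun p => ?_)
    simp only [Function.uncurry_def, Real.norm_eq_abs, abs_mul, abs_of_nonneg (rho_nonneg n _), one_mul, mul_assoc]
    refine mul_le_mul_of_nonneg_left ?_ (rho_nonneg n _)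
    exact mul_le_mul (hC _) (hD _) (abs_nonneg _) ((abs_nonneg _).trans (hC 0))

lemma fderiv_comp_coord {k : ℕ} {φ : R2 → (Fin k → ℝ)} {x : R2} (h : DifferentiableAt ℝ φ x)
    (e : R2) (i : Fin k) : fderiv ℝ φ x e i = fderiv ℝ (fun y => φ y i) x e := by
  rw [fderiv_apply h i]; rfl

/-- Regularized norm of the gradient. -/
def gg (v : R2 → ℝ) (η : ℝ) (x : R2) : ℝ := Real.sqrt (gradNormSq v x + η ^ 2)

lemma gradNormSq_nonneg (v : R2 → ℝ) (x : R2) : 0 ≤ gradNormSq v x := by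
  unfold gradNormSq; positivity

lemma gg_pos (v : R2 → ℝ) {η : ℝ} (hη : 0 < η) (x : R2) : 0 < gg v η x :=
  Real.sqrt_pos.2 (by have := gradNormSq_nonneg v x; positivity)

lemma gg_sq (v : R2 → ℝ) (η : ℝ) (x : R2) : gg v η x ^ 2 = gradNormSq v x + η ^ 2 :=
  Real.sq_sqrt (by have := gradNormSq_nonneg v x; positivity)

lemma gg_ge (v : R2 → ℝ) {η : ℝ} (hη : 0 < η) (x : R2) : η ≤ gg v η x :=
  Real.le_sqrt_of_sq_le (by have := gradNormSq_nonneg v x; linarith)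

lemma dv_contDiff {v : R2 → ℝ} (hv : ContDiff ℝ (⊤ : ℕ∞) v) (e : R2) :
    ContDiff ℝ (⊤ : ℕ∞) (fun x => fderiv ℝ v x e) :=
  (hv.fderiv_right (m := (⊤ : ℕ∞)) (by simp)).clm_apply contDiff_const

lemma gradNormSq_contDiff {v : R2 → ℝ} (hv : ContDiff ℝ (⊤ : ℕ∞) v) :
    ContDiff ℝ (⊤ : ℕ∞) (gradNormSq v) := by
  unfold gradNormSq
  exact ContDiff.sum fun j _ => (dv_contDiff hv _).pow 2

lemma gg_contDiff {v : R2 → ℝ} (hv : ContDiff ℝ (⊤ : ℕ∞) v) {η : ℝ} (hη : 0 < η) :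
    ContDiff ℝ (⊤ : ℕ∞) (gg v η) := by
  unfold gg
  refine ContDiff.sqrt ((gradNormSq_contDiff hv).add contDiff_const) fun x => ?_
  have := gradNormSq_nonneg v x
  positivity

lemma gradNormSq_per {v : R2 → ℝ} (hp : Per v) : Per (gradNormSq v) := by
  intro x n; unfold gradNormSq; rw [hp.fderiv x n]

lemma gg_per {v : R2 → ℝ} (hp : Per v) (η : ℝ) : Per (gg v η) := by
  intro x n; unfold gg; rw [gradNormSq_per hp x n]

lemma adm_shift {φ : R2 → R2} (h : IsAdmField φ) (y : R2) : IsAdmField (fun x => φ (x + y)) :=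
  ⟨h.1.comp (contDiff_id.add contDiff_const), (show Per φ from h.2.1).shift y, fun x => h.2.2 _⟩

lemma integral_moll_div_le (n : ℕ) {u : R2 → ℝ} (hm : Measurable u) (hp : Per u) {C : ℝ}
    (hC : ∀ x, |u x| ≤ C) (hb : BddAbove (TVset u)) {φ : R2 → R2} (hφ : IsAdmField φ) :
    ∫ x in cube, moll n u x * ∑ i, fderiv ℝ φ x (Pi.single i 1) i ≤ TV u := by
  have hφp : Per φ := hφ.2.1
  have hcont : Continuous (fun x => ∑ i, fderiv ℝ φ x (Pi.single i 1) i) := by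
    refine continuous_finsetSum _ fun i _ => ?_
    have := (hφ.1.continuous_fderiv (by simp)).clm_apply
      (continuous_const (y := (Pi.single i 1 : R2)))
    exact (continuous_apply i).comp this
  rw [integral_moll_mul n hm hp hC hcont
    (fun x k => by rw [hφp.fderiv x k])]
  have h1 : ∀ y, ∫ x in cube, u x * ∑ i, fderiv ℝ φ (x + y) (Pi.single i 1) i ≤ TV u := by
    intro y
    refine le_csSup hb ⟨_, adm_shift hφ y, ?_⟩
    congr 1; ext x; rw [fderiv_comp_add_right]
  have h2 : ∫ y, rho n y * TV u = TV u := by rw [integral_mul_const, rho_integral, one_mul]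
  rw [← h2]
  by_cases hi : Integrable (fun y => rho n y *
      ∫ x in cube, u x * ∑ i, fderiv ℝ φ (x + y) (Pi.single i 1) i)
  · exact integral_mono hi ((rho_integrable n).mul_const _)
      fun y => mul_le_mul_of_nonneg_left (h1 y) (rho_nonneg n y)
  · rw [integral_undef hi, h2]
    refine le_csSup hb ⟨fun _ => 0, ⟨contDiff_const, fun _ _ => rfl, fun _ => ?_⟩, ?_⟩
    · simp [en2]
    · simp

lemma integral_by_parts {v : R2 → ℝ} (hv : ContDiff ℝ (⊤ : ℕ∞) v) (hp : Per v)
    {φ : R2 → R2} (hφ : ContDiff ℝ (⊤ : ℕ∞) φ) (hφp : Per φ) :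
    ∫ x in cube, v x * ∑ i, fderiv ℝ φ x (Pi.single i 1) i
      = - ∫ x in cube, ∑ i, fderiv ℝ v x (Pi.single i 1) * φ x i := by
  have hφi : ∀ i, ContDiff ℝ (⊤ : ℕ∞) (fun x => φ x i) := fun i => contDiff_pi.1 hφ i
  have h0 : ∀ i : Fin 2, ∫ x in cube, (v x * fderiv ℝ φ x (Pi.single i 1) i
      + fderiv ℝ v x (Pi.single i 1) * φ x i) = 0 := by
    intro i
    rw [← integral_deriv_zero (f := fun x => v x * φ x i)
      (fun x k => by simp only; rw [hp x k, hφp x k]) ((hv.mul (hφi i)).of_le (by simp)) i]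
    congr 1; ext x
    rw [fderiv_fun_mul (hv.differentiable (by simp) x) ((hφi i).differentiable (by simp) x),
      fderiv_comp_coord (hφ.differentiable (by simp) x)]
    simp
    ring
  have hc1 : ∀ i : Fin 2, Continuous (fun x => v x * fderiv ℝ φ x (Pi.single i 1) i) := by
    intro i
    have := (hφ.continuous_fderiv (by simp)).clm_apply
      (continuous_const (y := (Pi.single i 1 : R2)))
    exact hv.continuous.mul ((continuous_apply i).comp this)
  have hc2 : ∀ i : Fin 2, Continuous (fun x => fderiv ℝ v x (Pi.single i 1) * φ x i) := by
    intro i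
    exact (dv_contDiff hv _).continuous.mul (hφi i).continuous
  rw [eq_neg_iff_add_eq_zero]
  simp only [Fin.sum_univ_two, mul_add]
  rw [integral_add (integrable_cube (hc1 0)) (integrable_cube (hc1 1)),
    integral_add (integrable_cube (hc2 0)) (integrable_cube (hc2 1))]
  have a0 := h0 0
  have a1 := h0 1
  rw [integral_add (integrable_cube (hc1 0)) (integrable_cube (hc2 0))] at a0
  rw [integral_add (integrable_cube (hc1 1)) (integrable_cube (hc2 1))] at a1
  linarith

lemma tv_bound (n : ℕ) {u : R2 → ℝ} (hm : Measurable u) (hp : Per u) {C : ℝ}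
    (hC : ∀ x, |u x| ≤ C) (hb : BddAbove (TVset u)) {η : ℝ} (hη : 0 < η) :
    ∫ x in cube, gg (moll n u) η x ≤ TV u + η := by
  set v := moll n u with hvdef
  have hv : ContDiff ℝ (⊤ : ℕ∞) v := moll_contDiff n hm hC
  have hvp : Per v := moll_per n hp
  have hg := gg_contDiff hv hη
  have hgp := gg_pos v hη
  let φ : R2 → R2 := fun x i => - (fderiv ℝ v x (Pi.single i 1) / gg v η x)
  have hφ : ContDiff ℝ (⊤ : ℕ∞) φ :=
    contDiff_pi.2 fun i => ((dv_contDiff hv _).div hg fun x => (hgp x).ne').neg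
  have hφp : Per φ := by
    intro x k; ext i
    simp only [φ]; rw [hvp.fderiv x k, gg_per hvp η x k]
  have hadm : IsAdmField φ := by
    refine ⟨hφ, hφp, fun x => ?_⟩
    unfold en2
    rw [Real.sqrt_le_one]
    simp only [φ, neg_sq, div_pow]
    rw [← Finset.sum_div, div_le_one (pow_pos (hgp x) 2), gg_sq]
    unfold gradNormSq
    have := sq_nonneg η
    linarith
  have h1 := integral_moll_div_le n hm hp hC hb hadm
  rw [← hvdef, integral_by_parts hv hvp hφ hφp, ← integral_neg] at h1
  have h2 : ∀ x, gg v η x - η ≤ -∑ i, fderiv ℝ v x (Pi.single i 1) * φ x i := by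
    intro x
    have e1 : -∑ i, fderiv ℝ v x (Pi.single i 1) * φ x i = gradNormSq v x / gg v η x := by
      simp only [φ, gradNormSq, Fin.sum_univ_two]
      have := (hgp x).ne'
      field_simp
      ring
    rw [e1, le_div_iff₀ (hgp x)]
    have := gg_sq v η x
    have := gg_ge v hη x
    nlinarith
  have hci : Continuous (fun x => -∑ i, fderiv ℝ v x (Pi.single i 1) * φ x i) := by
    refine (continuous_finsetSum _ fun i _ => ?_).neg
    exact (dv_contDiff hv _).continuous.mul (contDiff_pi.1 hφ i).continuous
  have h3 : ∫ x in cube, (gg v η x - η) ≤ TV u :=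
    (setIntegral_mono (integrable_cube (hg.continuous.sub continuous_const))
      (integrable_cube hci) h2).trans h1
  rw [integral_sub (integrable_cube hg.continuous) (integrable_const _)] at h3
  simp at h3
  linarith

/-- The squared hyperbolic secant. -/
def sech2 (s : ℝ) : ℝ := 1 / Real.cosh s ^ 2

lemma sech2_pos (s : ℝ) : 0 < sech2 s := by
  have := Real.cosh_pos s; unfold sech2; positivity

lemma one_sub_tanh_sq (s : ℝ) : 1 - Real.tanh s ^ 2 = sech2 s := by
  have := (Real.cosh_pos s).ne'
  have h := Real.cosh_sq s
  rw [Real.tanh_eq_sinh_div_cosh, sech2]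
  field_simp
  linarith

lemma hasDerivAt_tanh' (s : ℝ) : HasDerivAt Real.tanh (sech2 s) s := by
  have h0 := (Real.cosh_pos s).ne'
  have h := (Real.hasDerivAt_sinh s).div (Real.hasDerivAt_cosh s) h0
  have e : Real.tanh = Real.sinh / Real.cosh := by
    ext x; simp [Real.tanh_eq_sinh_div_cosh]
  rw [e]
  refine h.congr_deriv ?_
  have := Real.cosh_sq s
  unfold sech2
  congr 1
  linarith

lemma contDiff_tanh' : ContDiff ℝ (⊤ : ℕ∞) Real.tanh := by
  have e : Real.tanh = fun x => Real.sinh x / Real.cosh x := by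
    ext x; simp [Real.tanh_eq_sinh_div_cosh]
  rw [e]
  exact Real.contDiff_sinh.div Real.contDiff_cosh fun x => (Real.cosh_pos x).ne'

lemma tanh_mono' : Monotone Real.tanh :=
  monotone_of_hasDerivAt_nonneg hasDerivAt_tanh' fun s => (sech2_pos s).le

lemma sech2_continuous : Continuous sech2 := by
  unfold sech2
  exact continuous_const.div (Real.continuous_cosh.pow 2) fun x => by
    have := Real.cosh_pos x; positivity

lemma tanh_tendsto_atTop : Tendsto Real.tanh atTop (nhds 1) := by
  have e : Real.tanh = fun x => (1 - Real.exp (-x) ^ 2) / (1 + Real.exp (-x) ^ 2) := by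
    ext x
    rw [Real.tanh_eq, Real.exp_neg]
    have := (Real.exp_pos x).ne'
    field_simp
  rw [e]
  have h : Tendsto (fun x : ℝ => Real.exp (-x)) atTop (nhds 0) := Real.tendsto_exp_neg_atTop_nhds_zero
  have := ((h.pow 2).const_sub 1).div ((h.pow 2).const_add 1) (by norm_num)
  simp only [ne_eq, OfNat.ofNat_ne_zero, not_false_eq_true, zero_pow, sub_zero, add_zero, div_one] at this
  exact this

lemma tanh_tendsto_atBot : Tendsto Real.tanh atBot (nhds (-1)) := by
  have := (tanh_tendsto_atTop.comp tendsto_neg_atBot_atTop).neg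
  simpa [Function.comp_def] using this

lemma sech2_le (s : ℝ) : sech2 s ≤ 4 * Real.exp (-2 * |s|) := by
  have h1 : Real.exp |s| ≤ 2 * Real.cosh s := by
    rw [← Real.cosh_abs, Real.cosh_eq]
    have := Real.exp_pos (-|s|)
    linarith
  have h2 : Real.exp (-2 * |s|) = 1 / Real.exp |s| ^ 2 := by
    rw [show -2 * |s| = -(2 * |s|) by ring, Real.exp_neg, ← Real.exp_nat_mul, one_div]
    simp
  rw [h2, sech2, mul_one_div, div_le_div_iff₀ (by have := Real.cosh_pos s; positivity) (by positivity)]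
  have := Real.exp_pos |s|
  nlinarith

lemma sech2_weight_integrable : Integrable (fun s : ℝ => (1 + |s|) ^ 3 * sech2 s) := by
  have hI : Integrable (fun s : ℝ => (480 * Real.exp 1) * (1 + s ^ 2)⁻¹) :=
    integrable_inv_one_add_sq.const_mul _
  refine hI.mono' ?_ (Eventually.of_forall fun s => ?_)
  · exact (((continuous_const.add continuous_abs).pow 3).mul sech2_continuous).aestronglyMeasurable
  · have hs := abs_nonneg s
    have h0 := sech2_pos s
    rw [Real.norm_eq_abs, abs_of_nonneg (by positivity), ← div_eq_mul_inv, le_div_iff₀ (by positivity)]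
    have h1 := sech2_le s
    have h2 := Real.pow_div_factorial_le_exp (x := 1 + |s|) (by positivity) 5
    have h3 : (1 + |s|) ^ 5 ≤ 120 * Real.exp (1 + |s|) := by
      have : ((Nat.factorial 5 : ℕ) : ℝ) = 120 := by norm_num [Nat.factorial]
      rw [this, div_le_iff₀ (by norm_num)] at h2
      linarith
    have h4 : 1 + s ^ 2 ≤ (1 + |s|) ^ 2 := by
      rw [← sq_abs s]; nlinarith
    have h5 : Real.exp (1 + |s|) * Real.exp (-2 * |s|) ≤ Real.exp 1 := by
      rw [← Real.exp_add]; exact Real.exp_le_exp.2 (by linarith)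
    calc (1 + |s|) ^ 3 * sech2 s * (1 + s ^ 2) ≤ (1 + |s|) ^ 3 * sech2 s * (1 + |s|) ^ 2 :=
          mul_le_mul_of_nonneg_left h4 (by positivity)
      _ = (1 + |s|) ^ 5 * sech2 s := by ring
      _ ≤ (120 * Real.exp (1 + |s|)) * (4 * Real.exp (-2 * |s|)) := by gcongr
      _ = 480 * (Real.exp (1 + |s|) * Real.exp (-2 * |s|)) := by ring
      _ ≤ 480 * Real.exp 1 := by gcongr

lemma sech2_integrable : Integrable sech2 := by
  refine sech2_weight_integrable.mono' sech2_continuous.aestronglyMeasurable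
    (Eventually.of_forall fun s => ?_)
  have h0 := sech2_pos s
  rw [Real.norm_eq_abs, abs_of_pos h0]
  have : 1 ≤ (1 + |s|) ^ 3 := one_le_pow₀ (by have := abs_nonneg s; linarith)
  nlinarith

lemma sech2_integral : ∫ s, sech2 s = 2 := by
  rw [integral_of_hasDerivAt_of_tendsto hasDerivAt_tanh' sech2_integrable
    tanh_tendsto_atBot tanh_tendsto_atTop]
  norm_num

/-- Constant. -/
def C3 : ℝ := ∫ s, (1 + |s|) ^ 3 * sech2 s

lemma C3_nonneg : 0 ≤ C3 := integral_nonneg fun s => by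
  have := sech2_pos s; positivity

/-- The weight in the level parameter. -/
def wt (κ t : ℝ) : ℝ := max 0 (min 1 ((1 - |t|) / κ - 1))

lemma wt_nonneg (κ t : ℝ) : 0 ≤ wt κ t := le_max_left _ _

lemma wt_le_one (κ t : ℝ) : wt κ t ≤ 1 := max_le zero_le_one (min_le_left _ _)

lemma wt_continuous (κ : ℝ) : Continuous (wt κ) := by
  unfold wt; fun_prop

lemma wt_zero {κ t : ℝ} (hκ : 0 < κ) (h : 1 - κ ≤ |t|) : wt κ t = 0 := by
  unfold wt
  refine max_eq_left ((min_le_right _ _).trans ?_)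
  rw [sub_nonpos, div_le_one hκ]; linarith

lemma wt_one {κ t : ℝ} (hκ : 0 < κ) (h : |t| ≤ 1 - 2 * κ) : wt κ t = 1 := by
  unfold wt
  rw [min_eq_left, max_eq_right zero_le_one]
  rw [le_sub_iff_add_le, le_div_iff₀ hκ]; linarith

lemma wt_lip {κ : ℝ} (hκ : 0 < κ) (t t' : ℝ) : wt κ t ≤ wt κ t' + 1 / κ * |t - t'| := by
  unfold wt
  have h1 : (1 - |t|) / κ - 1 ≤ ((1 - |t'|) / κ - 1) + 1 / κ * |t - t'| := by
    have h2 : |t'| - |t| ≤ |t - t'| := by rw [abs_sub_comm]; exact abs_sub_abs_le_abs_sub _ _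
    have : (1 - |t|) / κ - 1 - ((1 - |t'|) / κ - 1) = 1 / κ * (|t'| - |t|) := by ring
    have : 1 / κ * (|t'| - |t|) ≤ 1 / κ * |t - t'| := by gcongr
    linarith
  have h3 : 0 ≤ 1 / κ * |t - t'| := by positivity
  refine max_le (by positivity) ?_
  rcases le_total 1 ((1 - |t'|) / κ - 1) with h | h
  · rw [min_eq_left h]
    have := min_le_left 1 ((1 - |t|) / κ - 1)
    have := le_max_right (0:ℝ) 1
    linarith
  · rw [min_eq_right h]
    have := min_le_right 1 ((1 - |t|) / κ - 1)
    have := le_max_right (0:ℝ) ((1 - |t'|) / κ - 1)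
    linarith

lemma wt_integral {κ : ℝ} (hκ : 0 < κ) (hκ2 : κ < 1 / 2) :
    2 * (1 - 2 * κ) ≤ ∫ t in Set.Icc (-1:ℝ) 1, wt κ t := by
  have h1 : ∫ t in Set.Icc (-(1 - 2 * κ)) (1 - 2 * κ), wt κ t = 2 * (1 - 2 * κ) := by
    rw [setIntegral_congr_fun (g := fun _ => (1:ℝ)) measurableSet_Icc]
    · simp
      rw [max_eq_left (by linarith)]; ring
    · intro t ht
      exact wt_one hκ (abs_le.2 ht)
  rw [← h1]
  refine setIntegral_mono_set ((wt_continuous κ).continuousOn.integrableOn_compact isCompact_Icc)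
    (Eventually.of_forall fun t => wt_nonneg κ t) ?_
  exact (Set.Icc_subset_Icc (by linarith) (by linarith)).eventuallyLE

/-- The rescaled level function. -/
def sv (v : R2 → ℝ) (η ε t : ℝ) (x : R2) : ℝ := (v x - t) / (ε * gg v η x)

/-- The transition layer map. -/
def mlay (v : R2 → ℝ) (η ε t : ℝ) (x : R2) : R3 :=
  ![1 / Real.cosh (sv v η ε t x), 0, Real.tanh (sv v η ε t x)]

lemma sv_contDiff {v : R2 → ℝ} (hv : ContDiff ℝ (⊤ : ℕ∞) v) {η ε : ℝ} (hη : 0 < η) (hε : 0 < ε)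
    (t : ℝ) : ContDiff ℝ (⊤ : ℕ∞) (sv v η ε t) := by
  unfold sv
  exact (hv.sub contDiff_const).div (contDiff_const.mul (gg_contDiff hv hη)) fun x =>
    (mul_pos hε (gg_pos v hη x)).ne'

lemma sv_per {v : R2 → ℝ} (hp : Per v) (η ε t : ℝ) : Per (sv v η ε t) := by
  intro x n; unfold sv; rw [hp x n, gg_per hp η x n]

lemma mt_contDiff {v : R2 → ℝ} (hv : ContDiff ℝ (⊤ : ℕ∞) v) {η ε : ℝ} (hη : 0 < η) (hε : 0 < ε)
    (t : ℝ) : ContDiff ℝ (⊤ : ℕ∞) (mlay v η ε t) := by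
  have hs := sv_contDiff hv hη hε t
  refine contDiff_pi.2 fun i => ?_
  fin_cases i
  · exact contDiff_const.div (Real.contDiff_cosh.comp hs) fun x => (Real.cosh_pos _).ne'
  · exact contDiff_const
  · exact contDiff_tanh'.comp hs

lemma sech_sq_add (s : ℝ) : (1 / Real.cosh s) ^ 2 + Real.tanh s ^ 2 = 1 := by
  have := one_sub_tanh_sq s
  rw [sech2] at this
  rw [div_pow, one_pow]; linarith

lemma mt_mag {v : R2 → ℝ} (hv : ContDiff ℝ (⊤ : ℕ∞) v) (hp : Per v) {η ε : ℝ} (hη : 0 < η)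
    (hε : 0 < ε) (t : ℝ) : Mag (mlay v η ε t) := by
  refine ⟨(mt_contDiff hv hη hε t).of_le (by simp), fun x n => ?_, fun x => ?_⟩
  · unfold mlay; rw [sv_per hp η ε t x n]
  · have := sech_sq_add (sv v η ε t x)
    simp only [mlay, Fin.sum_univ_three, Matrix.cons_val_zero, Matrix.cons_val_one, Matrix.cons_val]
    linarith

lemma gradVSq_mt {v : R2 → ℝ} (hv : ContDiff ℝ (⊤ : ℕ∞) v) {η ε : ℝ} (hη : 0 < η)
    (hε : 0 < ε) (t : ℝ) (x : R2) :
    gradVSq (mlay v η ε t) x = sech2 (sv v η ε t x) * gradNormSq (sv v η ε t) x := by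
  have hs : HasFDerivAt (sv v η ε t) (fderiv ℝ (sv v η ε t) x) x :=
    ((sv_contDiff hv hη hε t).differentiable (by simp) x).hasFDerivAt
  set s := sv v η ε t x with hsd
  have hd := (mt_contDiff hv hη hε t).differentiable (by simp) x
  have hc := (Real.cosh_pos s).ne'
  have h0 : ∀ e, fderiv ℝ (mlay v η ε t) x e 0
      = (-Real.sinh s / Real.cosh s ^ 2) * fderiv ℝ (sv v η ε t) x e := by
    intro e
    rw [fderiv_comp_coord hd]
    have h1 : HasDerivAt (fun r => 1 / Real.cosh r) (-Real.sinh s / Real.cosh s ^ 2) s := by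
      have := (Real.hasDerivAt_cosh s).inv hc
      simp only [one_div]
      exact this
    have := (h1.comp_hasFDerivAt x hs).fderiv
    have e1 : (fun y => mlay v η ε t y 0) = (fun r => 1 / Real.cosh r) ∘ sv v η ε t := rfl
    rw [e1, this]; rfl
  have h1 : ∀ e, fderiv ℝ (mlay v η ε t) x e 1 = 0 := by
    intro e
    rw [fderiv_comp_coord hd]
    have e1 : (fun y => mlay v η ε t y 1) = fun _ => 0 := rfl
    rw [e1]; simp
  have h2 : ∀ e, fderiv ℝ (mlay v η ε t) x e 2 = sech2 s * fderiv ℝ (sv v η ε t) x e := by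
    intro e
    rw [fderiv_comp_coord hd]
    have := ((hasDerivAt_tanh' s).comp_hasFDerivAt x hs).fderiv
    have e1 : (fun y => mlay v η ε t y 2) = Real.tanh ∘ sv v η ε t := rfl
    rw [e1, this]; rfl
  unfold gradVSq gradNormSq
  simp only [Fin.sum_univ_three, h0, h1, h2, Fin.sum_univ_two]
  have hcs := Real.cosh_sq s
  have key : (-Real.sinh s / Real.cosh s ^ 2) ^ 2 + sech2 s ^ 2 = sech2 s := by
    unfold sech2
    field_simp
    linarith
  generalize fderiv ℝ (sv v η ε t) x (Pi.single 0 1) = a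
  generalize fderiv ℝ (sv v η ε t) x (Pi.single 1 1) = b
  linear_combination (a ^ 2 + b ^ 2) * key

lemma fderiv_sv {v : R2 → ℝ} (hv : ContDiff ℝ (⊤ : ℕ∞) v) {η ε : ℝ} (hη : 0 < η)
    (hε : 0 < ε) (t : ℝ) (x e : R2) :
    fderiv ℝ (sv v η ε t) x e
      = (fderiv ℝ v x e - ε * sv v η ε t x * fderiv ℝ (gg v η) x e) / (ε * gg v η x) := by
  have hg := gg_pos v hη
  have hne : ∀ y, ε * gg v η y ≠ 0 := fun y => (mul_pos hε (hg y)).ne'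
  have hdg := (gg_contDiff hv hη).differentiable (by simp) x
  have hds := (sv_contDiff hv hη hε t).differentiable (by simp) x
  have e1 : v = fun y => sv v η ε t y * (ε * gg v η y) + t := by
    ext y; unfold sv; rw [div_mul_cancel₀ _ (hne y)]; ring
  have h2 : fderiv ℝ v x e = fderiv ℝ (sv v η ε t) x e * (ε * gg v η x)
      + sv v η ε t x * (ε * fderiv ℝ (gg v η) x e) := by
    conv_lhs => rw [e1]
    rw [fderiv_add_const, fderiv_fun_mul hds (hdg.const_mul ε), fderiv_const_mul hdg]
    simp
    ring
  rw [h2, eq_div_iff (hne x)]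
  ring

lemma cs_aux {a b c d A B k : ℝ} (hA : 0 ≤ A) (hB : 0 ≤ B) (h1 : a ^ 2 + b ^ 2 ≤ A ^ 2)
    (h2 : c ^ 2 + d ^ 2 ≤ B ^ 2) : (a - k * c) ^ 2 + (b - k * d) ^ 2 ≤ (A + |k| * B) ^ 2 := by
  have h3 : |a * c + b * d| ≤ A * B := by
    apply abs_le_of_sq_le_sq _ (by positivity)
    calc (a * c + b * d) ^ 2 ≤ (a ^ 2 + b ^ 2) * (c ^ 2 + d ^ 2) := by
          nlinarith [sq_nonneg (a * d - b * c)]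
      _ ≤ A ^ 2 * B ^ 2 := by gcongr
      _ = (A * B) ^ 2 := by ring
  have h4 : -(k * (a * c + b * d)) ≤ |k| * (A * B) := by
    refine (neg_le_abs _).trans ?_
    rw [abs_mul]; gcongr
  have h5 : k ^ 2 * (c ^ 2 + d ^ 2) ≤ |k| ^ 2 * B ^ 2 := by rw [sq_abs]; gcongr
  nlinarith

lemma local_bound {v : R2 → ℝ} (hv : ContDiff ℝ (⊤ : ℕ∞) v) (hp : Per v) {η : ℝ} (hη : 0 < η) :
    ∃ B : ℝ, 0 < B ∧ ∀ ε : ℝ, 0 < ε → ∀ t x,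
      ε / 2 * gradVSq (mlay v η ε t) x + (1 - (mlay v η ε t x 2) ^ 2) / (2 * ε)
        ≤ sech2 (sv v η ε t x) * (1 + ε * B * |sv v η ε t x|) ^ 2 / ε := by
  have hgc := gg_contDiff hv hη
  obtain ⟨D, hD0, hD⟩ := (gradNormSq_per (gg_per hp η)).exists_bound
    (gradNormSq_contDiff hgc).continuous
  refine ⟨Real.sqrt D / η, by positivity, fun ε hε t x => ?_⟩
  have hg := gg_pos v hη x
  set g := gg v η x with hgd
  set s := sv v η ε t x with hsd
  have hS := sech2_pos s
  have e1 : (mlay v η ε t x 2) = Real.tanh s := rfl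
  rw [gradVSq_mt hv hη hε, e1, one_sub_tanh_sq]
  have h1 : gradNormSq (sv v η ε t) x ≤ (1 + ε * (Real.sqrt D / η) * |s|) ^ 2 / ε ^ 2 := by
    unfold gradNormSq
    simp only [Fin.sum_univ_two, fderiv_sv hv hη hε, ← hsd, ← hgd]
    have h2 := cs_aux (A := g) (B := Real.sqrt D) (k := ε * s)
      (a := fderiv ℝ v x (Pi.single 0 1)) (b := fderiv ℝ v x (Pi.single 1 1))
      (c := fderiv ℝ (gg v η) x (Pi.single 0 1)) (d := fderiv ℝ (gg v η) x (Pi.single 1 1))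
      hg.le (Real.sqrt_nonneg _) (by
        have := gg_sq v η x
        rw [gradNormSq, Fin.sum_univ_two] at this
        have := sq_nonneg η
        linarith) (by
        rw [Real.sq_sqrt hD0.le]
        have := hD x
        rw [Real.norm_eq_abs, gradNormSq, Fin.sum_univ_two] at this
        exact (le_abs_self _).trans this)
    have h3 : g + |ε * s| * Real.sqrt D ≤ g * (1 + ε * (Real.sqrt D / η) * |s|) := by
      rw [abs_mul, abs_of_pos hε]
      have h4 := gg_ge v hη x
      have h5 : ε * |s| * Real.sqrt D = η * (ε * (Real.sqrt D / η) * |s|) := by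
        field_simp
      have h6 : η * (ε * (Real.sqrt D / η) * |s|) ≤ g * (ε * (Real.sqrt D / η) * |s|) := by
        gcongr
      linarith
    have h7 : (g + |ε * s| * Real.sqrt D) ^ 2 ≤ (g * (1 + ε * (Real.sqrt D / η) * |s|)) ^ 2 := by
      gcongr
    rw [div_pow, div_pow, ← add_div, div_le_div_iff₀ (by positivity) (by positivity)]
    calc _ ≤ (g * (1 + ε * (Real.sqrt D / η) * |s|)) ^ 2 * ε ^ 2 := by
          gcongr; exact h2.trans h7
      _ = _ := by ring
  have h8 : (1:ℝ) ≤ (1 + ε * (Real.sqrt D / η) * |s|) ^ 2 :=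
    one_le_pow₀ (by have : 0 ≤ ε * (Real.sqrt D / η) * |s| := by positivity
                    linarith)
  set Q := (1 + ε * (Real.sqrt D / η) * |s|) ^ 2 with hQ
  calc ε / 2 * (sech2 s * gradNormSq (sv v η ε t) x) + sech2 s / (2 * ε)
      ≤ ε / 2 * (sech2 s * (Q / ε ^ 2)) + sech2 s * Q / (2 * ε) := by
        gcongr
        nlinarith
    _ = sech2 s * Q / ε := by field_simp; ring

/-- Upper bound for the local energy density. -/
def edens (v : R2 → ℝ) (η B ε t : ℝ) (x : R2) : ℝ :=
  sech2 (sv v η ε t x) * (1 + ε * B * |sv v η ε t x|) ^ 2 / ε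

lemma sv_continuous2 {v : R2 → ℝ} (hv : ContDiff ℝ (⊤ : ℕ∞) v) {η ε : ℝ} (hη : 0 < η)
    (hε : 0 < ε) : Continuous (fun p : ℝ × R2 => sv v η ε p.1 p.2) := by
  unfold sv
  have h1 := hv.continuous
  have h2 := (gg_contDiff hv hη).continuous
  refine Continuous.div (by fun_prop) (by fun_prop) fun p => (mul_pos hε (gg_pos v hη _)).ne'

lemma edens_continuous2 {v : R2 → ℝ} (hv : ContDiff ℝ (⊤ : ℕ∞) v) {η ε : ℝ} (hη : 0 < η)
    (hε : 0 < ε) (B : ℝ) : Continuous (fun p : ℝ × R2 => edens v η B ε p.1 p.2) := by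
  unfold edens
  have h1 := sv_continuous2 hv hη hε
  have h2 := sech2_continuous
  fun_prop

lemma avg_local_pt {κ B G ε w0 g : ℝ} (hκ : 0 < κ) (hB : 0 < B) (hε : 0 < ε) (hε1 : ε ≤ 1)
    (hg : 0 < g) (hgG : g ≤ G) :
    ∫ t in Set.Icc (-1:ℝ) 1, wt κ t * (sech2 ((w0 - t) / (ε * g)) *
      (1 + ε * B * |(w0 - t) / (ε * g)|) ^ 2 / ε)
      ≤ 2 * wt κ w0 * g + ε * (G * ((2 * B + B ^ 2 + G / κ * (1 + B) ^ 2) * C3)) := by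
  set K1 := 2 * B + B ^ 2 + G / κ * (1 + B) ^ 2 with hK1
  have hG : 0 < G := hg.trans_le hgG
  have hK1p : 0 ≤ K1 := by positivity
  have hc : 0 < ε * g := mul_pos hε hg
  rw [setIntegral_eq_integral_of_forall_compl_eq_zero]
  swap
  · intro t ht
    rw [wt_zero hκ, zero_mul]
    by_contra h
    push Not at h
    exact ht (abs_le.1 (by linarith))
  rw [← integral_sub_left_eq_self _ volume w0]
  have e1 : ∀ t : ℝ, wt κ (w0 - t) * (sech2 ((w0 - (w0 - t)) / (ε * g)) *
      (1 + ε * B * |(w0 - (w0 - t)) / (ε * g)|) ^ 2 / ε)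
      = (fun s => wt κ (w0 - (ε * g) * s) * (sech2 s * (1 + ε * B * |s|) ^ 2 / ε)) (t / (ε * g)) := by
    intro t
    simp only [sub_sub_cancel]
    rw [mul_div_cancel₀ _ hc.ne']
  rw [integral_congr_ae (Eventually.of_forall e1), Measure.integral_comp_div (fun s => wt κ (w0 - (ε * g) * s) * (sech2 s * (1 + ε * B * |s|) ^ 2 / ε)), abs_of_pos hc, smul_eq_mul]
  have h2 : ∫ s, wt κ (w0 - (ε * g) * s) * (sech2 s * (1 + ε * B * |s|) ^ 2 / ε)
      ≤ ∫ s, (wt κ w0 / ε * sech2 s + K1 * ((1 + |s|) ^ 3 * sech2 s)) := by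
    refine integral_mono_of_nonneg (Eventually.of_forall fun s => ?_)
      ((sech2_integrable.const_mul _).add (sech2_weight_integrable.const_mul _))
      (Eventually.of_forall fun s => ?_)
    · have := wt_nonneg κ (w0 - (ε * g) * s)
      have := sech2_pos s
      simp only [Pi.zero_apply]
      positivity
    · simp only
      have hS := sech2_pos s
      have h3 := wt_lip hκ (w0 - (ε * g) * s) w0
      have h4 : |w0 - ε * g * s - w0| = ε * g * |s| := by
        rw [show w0 - ε * g * s - w0 = -((ε * g) * s) by ring, abs_neg, abs_mul, abs_of_pos hc]
      rw [h4] at h3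
      have hw1 := wt_le_one κ w0
      have hw0 := wt_nonneg κ w0
      have hs0 := abs_nonneg s
      set r := |s| with hr
      have h5 : wt κ (w0 - ε * g * s) * (1 + ε * B * r) ^ 2
          ≤ wt κ w0 + ε * (K1 * (1 + r) ^ 3) := by
        have a1 : (1 + ε * B * r) ^ 2 ≤ 1 + ε * (2 * B + B ^ 2) * (1 + r) ^ 2 := by
          have b1 : ε ^ 2 * (B * r) ^ 2 ≤ ε * (B * r) ^ 2 := by
            have : ε ^ 2 ≤ ε := by nlinarith
            gcongr
          have b2 : 0 ≤ ε * B := by positivity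
          have b3 : 0 ≤ ε * B ^ 2 := by positivity
          nlinarith [mul_nonneg b2 hs0, mul_nonneg b3 hs0, mul_nonneg b2 (sq_nonneg r)]
        have a2 : (1 + ε * B * r) ^ 2 ≤ (1 + B) ^ 2 * (1 + r) ^ 2 := by
          rw [← mul_pow]
          have : ε * B * r ≤ 1 * B * r := by gcongr
          gcongr
          nlinarith
        have a3 : (1 + r) ^ 2 ≤ (1 + r) ^ 3 := pow_le_pow_right₀ (by linarith) (by norm_num)
        have a4 : r * (1 + r) ^ 2 ≤ (1 + r) ^ 3 := by nlinarith [sq_nonneg (1 + r)]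
        calc wt κ (w0 - ε * g * s) * (1 + ε * B * r) ^ 2
            ≤ (wt κ w0 + 1 / κ * (ε * g * r)) * (1 + ε * B * r) ^ 2 := by gcongr
          _ = wt κ w0 * (1 + ε * B * r) ^ 2 + ε * (g / κ * (r * (1 + ε * B * r) ^ 2)) := by ring
          _ ≤ wt κ w0 * (1 + ε * (2 * B + B ^ 2) * (1 + r) ^ 2)
              + ε * (G / κ * (r * ((1 + B) ^ 2 * (1 + r) ^ 2))) := by gcongr
          _ = wt κ w0 + wt κ w0 * (ε * (2 * B + B ^ 2) * (1 + r) ^ 2)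
              + ε * (G / κ * (1 + B) ^ 2 * (r * (1 + r) ^ 2)) := by ring
          _ ≤ wt κ w0 + 1 * (ε * (2 * B + B ^ 2) * (1 + r) ^ 3)
              + ε * (G / κ * (1 + B) ^ 2 * (1 + r) ^ 3) := by gcongr
          _ = wt κ w0 + ε * (K1 * (1 + r) ^ 3) := by rw [hK1]; ring
      calc wt κ (w0 - ε * g * s) * (sech2 s * (1 + ε * B * r) ^ 2 / ε)
          = (wt κ (w0 - ε * g * s) * (1 + ε * B * r) ^ 2) * (sech2 s / ε) := by ring
        _ ≤ (wt κ w0 + ε * (K1 * (1 + r) ^ 3)) * (sech2 s / ε) := by gcongr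
        _ = _ := by field_simp
  rw [integral_add (sech2_integrable.const_mul _) (sech2_weight_integrable.const_mul _),
    integral_const_mul, integral_const_mul, sech2_integral] at h2
  calc _ ≤ ε * g * (wt κ w0 / ε * 2 + K1 * C3) := by gcongr; exact h2
    _ = 2 * wt κ w0 * g + ε * (g * (K1 * C3)) := by field_simp
    _ ≤ _ := by
      have := C3_nonneg
      gcongr

lemma avg_local {v : R2 → ℝ} (hv : ContDiff ℝ (⊤ : ℕ∞) v) (hp : Per v) {η κ B : ℝ} (hη : 0 < η)
    (hκ : 0 < κ) (hB : 0 < B) : ∃ K : ℝ, ∀ ε : ℝ, 0 < ε → ε ≤ 1 →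
      ∫ t in Set.Icc (-1:ℝ) 1, wt κ t * ∫ x in cube, edens v η B ε t x
        ≤ (∫ x in cube, 2 * wt κ (v x) * gg v η x) + ε * K := by
  have hgc := (gg_contDiff hv hη).continuous
  obtain ⟨G, hG0, hG⟩ := (gg_per hp η).exists_bound hgc
  refine ⟨G * ((2 * B + B ^ 2 + G / κ * (1 + B) ^ 2) * C3), fun ε hε hε1 => ?_⟩
  have hcont : Continuous (fun p : ℝ × R2 => wt κ p.1 * edens v η B ε p.1 p.2) :=
    ((wt_continuous κ).comp continuous_fst).mul (edens_continuous2 hv hη hε B)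
  have hI := integrable_prod_cube hcont (-1) 1
  simp_rw [← integral_const_mul]
  rw [integral_integral_swap hI]
  have hc2 : Continuous (fun x => 2 * wt κ (v x) * gg v η x) := by
    have := (wt_continuous κ).comp hv.continuous
    exact (continuous_const.mul this).mul hgc
  have h1 : ∫ x in cube, (2 * wt κ (v x) * gg v η x
      + ε * (G * ((2 * B + B ^ 2 + G / κ * (1 + B) ^ 2) * C3)))
      = (∫ x in cube, 2 * wt κ (v x) * gg v η x)
        + ε * (G * ((2 * B + B ^ 2 + G / κ * (1 + B) ^ 2) * C3)) := by
    rw [integral_add (integrable_cube hc2) (integrable_const _)]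
    simp
  rw [← h1]
  refine integral_mono hI.integral_prod_right
    ((integrable_cube hc2).add (integrable_const _)) fun x => ?_
  exact avg_local_pt hκ hB hε hε1 (gg_pos v hη x) ((le_abs_self _).trans (hG x))

/-- The annulus. -/
def ann (ε : ℝ) : Set R2 := {z | ε < en2 z ∧ en2 z < 1}

lemma en2_continuous : Continuous en2 := by unfold en2; fun_prop

lemma en2_nonneg (z : R2) : 0 ≤ en2 z := Real.sqrt_nonneg _

lemma norm_le_en2 (z : R2) : ‖z‖ ≤ en2 z := by
  rw [pi_norm_le_iff_of_nonneg (en2_nonneg z)]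
  intro i
  rw [Real.norm_eq_abs, en2]
  apply Real.abs_le_sqrt
  exact Finset.single_le_sum (f := fun i => z i ^ 2) (fun i _ => sq_nonneg _) (Finset.mem_univ i)

lemma measurableSet_ann (ε : ℝ) : MeasurableSet (ann ε) :=
  (measurableSet_lt measurable_const en2_continuous.measurable).inter
    (measurableSet_lt en2_continuous.measurable measurable_const)

lemma volume_ann_lt_top (ε : ℝ) : volume (ann ε) < ⊤ := by
  refine (measure_mono (t := Metric.ball 0 1) ?_).trans_lt measure_ball_lt_top
  intro z hz
  rw [mem_ball_zero_iff]
  exact (norm_le_en2 z).trans_lt hz.2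

lemma polar_ann {ε : ℝ} (hε : 0 < ε) {Φ : R2 → ℝ} {a ψ : ℝ → ℝ}
    (h : ∀ r θ, 0 < r → Φ ![r * Real.cos θ, r * Real.sin θ] = a r * ψ θ) :
    ∫ z in ann ε, Φ z = (∫ r in Set.Ioo ε 1, r * a r) * ∫ θ in Set.Ioo (-π) π, ψ θ := by
  rw [← integral_indicator (measurableSet_ann ε)]
  have h1 := (volume_preserving_finTwoArrow ℝ).symm.integral_comp'
    (g := (ann ε).indicator Φ)
  rw [← h1, ← integral_comp_polarCoord_symm]
  have ht : polarCoord.target = Set.Ioi (0:ℝ) ×ˢ Set.Ioo (-π) π := rfl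
  rw [ht]
  have h2 : Set.EqOn (fun p : ℝ × ℝ => p.1 • (ann ε).indicator Φ
      ((MeasurableEquiv.finTwoArrow (α := ℝ)).symm (polarCoord.symm p)))
      (fun p : ℝ × ℝ => (Set.Ioo ε 1).indicator (fun r => r * a r) p.1 * ψ p.2)
      (Set.Ioi (0:ℝ) ×ˢ Set.Ioo (-π) π) := by
    rintro ⟨r, θ⟩ ⟨hr, -⟩
    have hr : 0 < r := hr
    have e1 : (MeasurableEquiv.finTwoArrow (α := ℝ)).symm (polarCoord.symm (r, θ))
        = ![r * Real.cos θ, r * Real.sin θ] := by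
      rfl
    have e2 : en2 ![r * Real.cos θ, r * Real.sin θ] = r := by
      unfold en2
      simp only [Fin.sum_univ_two, Matrix.cons_val_zero, Matrix.cons_val_one]
      rw [show (r * Real.cos θ) ^ 2 + (r * Real.sin θ) ^ 2 = r ^ 2 by
        rw [mul_pow, mul_pow, ← mul_add, Real.cos_sq_add_sin_sq, mul_one], Real.sqrt_sq hr.le]
    simp only [e1, smul_eq_mul]
    by_cases hrm : r ∈ Set.Ioo ε 1
    · rw [Set.indicator_of_mem hrm, Set.indicator_of_mem (show _ ∈ ann ε from by
        rw [ann, Set.mem_ofPred_eq, e2]; exact hrm), h r θ hr]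
      ring
    · rw [Set.indicator_of_notMem hrm, Set.indicator_of_notMem (show _ ∉ ann ε from by
        rw [ann, Set.mem_ofPred_eq, e2]; exact hrm)]
      simp
  rw [setIntegral_congr_fun (measurableSet_Ioi.prod measurableSet_Ioo) h2]
  rw [Measure.volume_eq_prod, setIntegral_prod_mul]
  congr 1
  rw [integral_indicator measurableSet_Ioo, Measure.restrict_restrict measurableSet_Ioo]
  congr 2
  exact Set.inter_eq_left.2 fun r hr => hε.trans hr.1

lemma integral_abs_cos (φ : ℝ) : ∫ θ in Set.Ioo (-π) π, |Real.cos (θ - φ)| = 4 := by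
  rw [← integral_Ioc_eq_integral_Ioo, ← intervalIntegral.integral_of_le (by linarith [Real.pi_pos])]
  rw [intervalIntegral.integral_comp_sub_right (fun θ => |Real.cos θ|)]
  have hper : Function.Periodic (fun θ => |Real.cos θ|) (2 * π) := by
    intro θ; simp only [Real.cos_add_two_pi]
  have h1 := hper.intervalIntegral_add_eq (-π - φ) (-(π / 2))
  rw [show -π - φ + 2 * π = π - φ by ring] at h1
  rw [h1]
  have hi : ∀ a b, IntervalIntegrable (fun θ => |Real.cos θ|) volume a b := fun a b =>
    (Real.continuous_cos.abs).intervalIntegrable a b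
  rw [← intervalIntegral.integral_add_adjacent_intervals (hi _ (π / 2)) (hi _ _)]
  have hp := Real.pi_pos
  have h2 : ∫ θ in (-(π / 2))..(π / 2), |Real.cos θ| = 2 := by
    rw [intervalIntegral.integral_congr (g := Real.cos)]
    · rw [integral_cos]; simp; norm_num
    · intro θ hθ
      rw [Set.uIcc_of_le (by linarith)] at hθ
      exact abs_of_nonneg (Real.cos_nonneg_of_mem_Icc hθ)
  have h3 : ∫ θ in (π / 2)..(-(π / 2) + 2 * π), |Real.cos θ| = 2 := by
    rw [intervalIntegral.integral_congr (g := fun θ => - Real.cos θ)]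
    · rw [intervalIntegral.integral_neg, integral_cos, Real.sin_add_two_pi]; simp; norm_num
    · intro θ hθ
      rw [Set.uIcc_of_le (by linarith)] at hθ
      exact abs_of_nonpos (Real.cos_nonpos_of_pi_div_two_le_of_le hθ.1 (by linarith [hθ.2]))
  rw [h2, h3]; norm_num

lemma integral_abs_lin (p q : ℝ) :
    ∫ θ in Set.Ioo (-π) π, |p * Real.cos θ + q * Real.sin θ| = 4 * Real.sqrt (p ^ 2 + q ^ 2) := by
  set z : ℂ := ⟨p, q⟩ with hz
  have hp : p = ‖z‖ * Real.cos z.arg := by rw [Complex.norm_mul_cos_arg]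
  have hq : q = ‖z‖ * Real.sin z.arg := by rw [Complex.norm_mul_sin_arg]
  have hn : Real.sqrt (p ^ 2 + q ^ 2) = ‖z‖ := by
    rw [Complex.norm_def, Complex.normSq_apply]
    congr 1
    simp only [hz]; ring
  have e : ∀ θ, |p * Real.cos θ + q * Real.sin θ| = ‖z‖ * |Real.cos (θ - z.arg)| := by
    intro θ
    rw [Real.cos_sub, ← abs_of_nonneg (norm_nonneg z), ← abs_mul]
    congr 1
    conv_lhs => rw [hp, hq]
    ring
  simp_rw [e]
  rw [integral_const_mul, integral_abs_cos, hn]; ring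

lemma en2_polar {r : ℝ} (θ : ℝ) (hr : 0 < r) : en2 ![r * Real.cos θ, r * Real.sin θ] = r := by
  unfold en2
  simp only [Fin.sum_univ_two, Matrix.cons_val_zero, Matrix.cons_val_one]
  rw [show (r * Real.cos θ) ^ 2 + (r * Real.sin θ) ^ 2 = r ^ 2 by
    rw [mul_pow, mul_pow, ← mul_add, Real.cos_sq_add_sin_sq, mul_one], Real.sqrt_sq hr.le]

lemma ann_lin {ε : ℝ} (hε : 0 < ε) (hε1 : ε < 1) (p q : ℝ) :
    ∫ z in ann ε, |p * z 0 + q * z 1| / en2 z ^ 3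
      = |Real.log ε| * (4 * Real.sqrt (p ^ 2 + q ^ 2)) := by
  rw [polar_ann hε (a := fun r => r⁻¹ ^ 2) (ψ := fun θ => |p * Real.cos θ + q * Real.sin θ|),
    integral_abs_lin]
  · congr 1
    rw [setIntegral_congr_fun (g := fun r => r⁻¹) measurableSet_Ioo,
      ← integral_Ioc_eq_integral_Ioo, ← intervalIntegral.integral_of_le hε1.le,
      integral_inv_of_pos hε one_pos, Real.log_div one_ne_zero hε.ne', Real.log_one,
      abs_of_neg (Real.log_neg hε hε1), zero_sub]
    intro r hr
    have : 0 < r := hε.trans hr.1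
    simp only; field_simp
  · intro r θ hr
    rw [en2_polar θ hr]
    simp only [Matrix.cons_val_zero, Matrix.cons_val_one]
    rw [show p * (r * Real.cos θ) + q * (r * Real.sin θ) = r * (p * Real.cos θ + q * Real.sin θ) by
      ring, abs_mul, abs_of_pos hr]
    field_simp

lemma ann_one {ε : ℝ} (hε : 0 < ε) (hε1 : ε < 1) :
    ∫ z in ann ε, ε / en2 z ^ 3 ≤ 2 * π := by
  rw [polar_ann hε (a := fun r => ε * r ^ (-3 : ℤ)) (ψ := fun θ => 1)]
  · have e1 : ∫ r in Set.Ioo ε 1, r * (ε * r ^ (-3 : ℤ)) = 1 - ε := by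
      rw [setIntegral_congr_fun (g := fun r => ε * r ^ (-2 : ℤ)) measurableSet_Ioo,
        integral_const_mul,
        ← integral_Ioc_eq_integral_Ioo, ← intervalIntegral.integral_of_le hε1.le, integral_zpow]
      · norm_num
        field_simp
        ring
      · right
        refine ⟨by norm_num, ?_⟩
        rw [Set.uIcc_of_le hε1.le]
        exact fun h => absurd h.1 (by linarith)
      · intro r hr
        have : 0 < r := hε.trans hr.1
        simp only
        rw [show (-2 : ℤ) = 1 + (-3) by norm_num, zpow_add₀ this.ne']
        simp; ring
    rw [e1]
    simp
    have := Real.pi_pos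
    rw [max_eq_left (by linarith)]
    nlinarith
  · intro r θ hr
    rw [en2_polar θ hr, mul_one, zpow_neg, div_eq_mul_inv]
    rfl

lemma ann_sq {ε : ℝ} (hε : 0 < ε) (hε1 : ε < 1) :
    ∫ z in ann ε, en2 z ^ 2 / en2 z ^ 3 ≤ 2 * π := by
  rw [polar_ann hε (a := fun r => r⁻¹) (ψ := fun θ => 1)]
  · rw [setIntegral_congr_fun (g := fun r => 1) measurableSet_Ioo]
    · simp
      have := Real.pi_pos
      rw [max_eq_left (by linarith), max_eq_left (by linarith)]
      nlinarith
    · intro r hr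
      have : 0 < r := hε.trans hr.1
      simp only; field_simp
  · intro r θ hr
    rw [en2_polar θ hr, mul_one]
    field_simp

lemma bound_integrable (L : ℝ) :
    Integrable (fun z : R2 => min (L ^ 2 * ‖z‖ ^ 2) 4 / ‖z‖ ^ 3) := by
  refine (integrable_fun_norm_addHaar (E := R2) volume
    (f := fun r => min (L ^ 2 * r ^ 2) 4 / r ^ 3)).2 ?_
  have hd : Module.finrank ℝ R2 - 1 = 1 := by simp
  rw [hd, ← Set.Ioc_union_Ioi_eq_Ioi (zero_le_one (α := ℝ))]
  have hm : Measurable (fun y : ℝ => y ^ 1 • (min (L ^ 2 * y ^ 2) 4 / y ^ 3)) := by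
    simp only [smul_eq_mul]; fun_prop
  have hnn : ∀ y : ℝ, 0 < y → 0 ≤ y ^ 1 • (min (L ^ 2 * y ^ 2) 4 / y ^ 3) := fun y hy => by
    simp only [smul_eq_mul]; positivity
  refine IntegrableOn.union ?_ ?_
  · refine Integrable.mono' (g := fun _ => L ^ 2) (integrable_const _) hm.aestronglyMeasurable ?_
    refine (ae_restrict_iff' measurableSet_Ioc).2 (Eventually.of_forall fun y hy => ?_)
    rw [Real.norm_of_nonneg (hnn y hy.1), smul_eq_mul, pow_one, mul_div_assoc',
      div_le_iff₀ (pow_pos hy.1 3)]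
    calc y * min (L ^ 2 * y ^ 2) 4 ≤ y * (L ^ 2 * y ^ 2) :=
          mul_le_mul_of_nonneg_left (min_le_left _ _) hy.1.le
      _ = _ := by ring
  · refine Integrable.mono' (g := fun y : ℝ => 4 * y ^ (-2 : ℝ))
      ((integrableOn_Ioi_rpow_of_lt (by norm_num) one_pos).const_mul 4) hm.aestronglyMeasurable ?_
    refine (ae_restrict_iff' measurableSet_Ioi).2 (Eventually.of_forall fun y hy => ?_)
    have hy0 : (0:ℝ) < y := zero_lt_one.trans hy
    rw [Real.norm_of_nonneg (hnn y hy0), smul_eq_mul, pow_one, mul_div_assoc',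
      div_le_iff₀ (pow_pos hy0 3), Real.rpow_neg hy0.le, Real.rpow_ofNat]
    calc y * min (L ^ 2 * y ^ 2) 4 ≤ y * 4 :=
          mul_le_mul_of_nonneg_left (min_le_right _ _) hy0.le
      _ = _ := by field_simp

lemma per_lip {f : R2 → ℝ} (hf : ContDiff ℝ 1 f) (hp : Per f) :
    ∃ L : ℝ, 0 < L ∧ ∀ x z, |f (x + z) - f x| ≤ L * ‖z‖ := by
  obtain ⟨L, hL, hb⟩ := hp.fderiv.exists_bound (hf.continuous_fderiv (by norm_num))
  refine ⟨L, hL, fun x z => ?_⟩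
  have := Convex.norm_image_sub_le_of_norm_fderiv_le (𝕜 := ℝ) (f := f) (s := Set.univ) (C := L)
    (fun x _ => (hf.differentiable (by norm_num)).differentiableAt) (fun x _ => hb x) convex_univ
    (Set.mem_univ x) (Set.mem_univ (x + z))
  simpa using this

lemma H12_lower {f : R2 → ℝ} (hf : ContDiff ℝ 1 f) (hp : Per f) (hb : ∀ x, |f x| ≤ 1) (ε : ℝ) :
    (1 / (4 * π)) * ∫ x in cube, ∫ z in ann ε, (f (x + z) - f x) ^ 2 / en2 z ^ 3 ≤ H12 f := by
  obtain ⟨L, hL, hlip⟩ := per_lip hf hp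
  have hc := hf.continuous
  have hbd : ∀ x z, ‖(f (x + z) - f x) ^ 2 / en2 z ^ 3‖
      ≤ min (L ^ 2 * ‖z‖ ^ 2) 4 / ‖z‖ ^ 3 := by
    intro x z
    have h1 := norm_le_en2 z
    rw [Real.norm_of_nonneg (div_nonneg (sq_nonneg _) (pow_nonneg (en2_nonneg z) 3))]
    rcases eq_or_ne z 0 with rfl | hz
    · simp
    have hz0 : 0 < ‖z‖ := norm_pos_iff.2 hz
    apply div_le_div₀ (by positivity) _ (by positivity) (pow_le_pow_left₀ hz0.le h1 3)
    refine le_min ?_ ?_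
    · rw [← mul_pow, ← sq_abs]
      exact pow_le_pow_left₀ (abs_nonneg _) (hlip x z) 2
    · have a1 := abs_le.1 (hb (x + z)); have a2 := abs_le.1 (hb x)
      have : |f (x + z) - f x| ≤ 2 := abs_le.2 ⟨by linarith [a1.1, a2.2], by linarith [a1.2, a2.1]⟩
      rw [← sq_abs]; nlinarith [abs_nonneg (f (x + z) - f x)]
  have hmeas : ∀ x, Measurable (fun z => (f (x + z) - f x) ^ 2 / en2 z ^ 3) := fun x =>
    (((hc.comp (continuous_const.add continuous_id)).sub continuous_const).pow 2).measurable.div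
      (en2_continuous.pow 3).measurable
  have hinteg : ∀ x, Integrable (fun z => (f (x + z) - f x) ^ 2 / en2 z ^ 3) := fun x =>
    (bound_integrable L).mono' (hmeas x).aestronglyMeasurable (Eventually.of_forall (hbd x))
  have hcx : ∀ z, Continuous (fun x => (f (x + z) - f x) ^ 2 / en2 z ^ 3) := fun z => by
    have : Continuous (fun x => f (x + z)) := hc.comp (continuous_id.add continuous_const)
    exact ((this.sub hc).pow 2).div_const _
  unfold H12
  refine mul_le_mul_of_nonneg_left ?_ (by positivity)
  apply integral_mono
  · exact integrable_cube (continuous_of_dominated (fun x => (hmeas x).aestronglyMeasurable)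
      (fun x => Eventually.of_forall (hbd x)) (bound_integrable L).integrableOn
      (Eventually.of_forall hcx))
  · exact integrable_cube (continuous_of_dominated (fun x => (hmeas x).aestronglyMeasurable)
      (fun x => Eventually.of_forall (hbd x)) (bound_integrable L)
      (Eventually.of_forall hcx))
  · intro x
    exact setIntegral_le_integral (hinteg x) (Eventually.of_forall fun z =>
      div_nonneg (sq_nonneg _) (pow_nonneg (en2_nonneg z) 3))

lemma tanh_diff_aux {M ε G ga gb a b t : ℝ} (hM : 0 ≤ M) (hε : 0 < ε) (ha : 0 < ga) (hb : 0 < gb)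
    (haG : ga ≤ G) (hbG : gb ≤ G) (h1 : min a b + M * ε * G ≤ t) (h2 : t ≤ max a b - M * ε * G) :
    4 * Real.tanh M ^ 2 ≤
      (Real.tanh ((b - t) / (ε * gb)) - Real.tanh ((a - t) / (ε * ga))) ^ 2 := by
  have hT : 0 ≤ Real.tanh M := by rw [← Real.tanh_zero]; exact tanh_mono' hM
  have up : ∀ {c g : ℝ}, 0 < g → g ≤ G → M * ε * G ≤ c → Real.tanh M ≤ Real.tanh (c / (ε * g)) := by
    intro c g hg hgG hc
    apply tanh_mono'
    rw [le_div_iff₀ (by positivity)]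
    have : M * ε * g ≤ M * ε * G := mul_le_mul_of_nonneg_left hgG (by positivity)
    linarith
  have dn : ∀ {c g : ℝ}, 0 < g → g ≤ G → M * ε * G ≤ -c → Real.tanh (c / (ε * g)) ≤ - Real.tanh M := by
    intro c g hg hgG hc
    have := up hg hgG hc
    rw [neg_div, Real.tanh_neg] at this
    linarith
  rcases le_total a b with hab | hab
  · rw [min_eq_left hab] at h1; rw [max_eq_right hab] at h2
    have u1 := up hb hbG (c := b - t) (by linarith)
    have u2 := dn ha haG (c := a - t) (by linarith)
    nlinarith
  · rw [min_eq_right hab] at h1; rw [max_eq_left hab] at h2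
    have u1 := up ha haG (c := a - t) (by linarith)
    have u2 := dn hb hbG (c := b - t) (by linarith)
    nlinarith

lemma nonlocal_pt {κ M ε G ga gb a b : ℝ} (hκ : 0 < κ) (hM : 0 ≤ M) (hε : 0 < ε) (ha : 0 < ga)
    (hb : 0 < gb) (haG : ga ≤ G) (hbG : gb ≤ G) :
    4 * Real.tanh M ^ 2 * (wt κ a * (|b - a| - 2 * M * ε * G) - |b - a| ^ 2 / κ)
      ≤ ∫ t in Set.Icc (-1:ℝ) 1, wt κ t *
        (Real.tanh ((b - t) / (ε * gb)) - Real.tanh ((a - t) / (ε * ga))) ^ 2 := by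
  have hG : 0 < G := ha.trans_le haG
  set D := |b - a| with hD
  have hD0 : 0 ≤ D := abs_nonneg _
  set F : ℝ → ℝ := fun t => wt κ t *
        (Real.tanh ((b - t) / (ε * gb)) - Real.tanh ((a - t) / (ε * ga))) ^ 2 with hF
  have hFnn : ∀ t, 0 ≤ F t := fun t => mul_nonneg (wt_nonneg _ _) (sq_nonneg _)
  have ht := contDiff_tanh'.continuous
  have hFc : Continuous F := by
    have := wt_continuous κ
    simp only [hF]
    refine this.mul (((ht.comp ?_).sub (ht.comp ?_)).pow 2)
    · fun_prop
    · fun_prop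
  rcases le_or_gt D (2 * M * ε * G) with hle | hgt
  · refine le_trans ?_ (integral_nonneg hFnn)
    apply mul_nonpos_of_nonneg_of_nonpos (by positivity)
    have : wt κ a * (D - 2 * M * ε * G) ≤ 0 :=
      mul_nonpos_of_nonneg_of_nonpos (wt_nonneg _ _) (by linarith)
    have : 0 ≤ D ^ 2 / κ := by positivity
    linarith
  have hz : ∀ t, t ∉ Set.Icc (-1:ℝ) 1 → F t = 0 := by
    intro t ht
    simp only [hF]
    rw [wt_zero hκ, zero_mul]
    by_contra h
    push Not at h
    have := abs_lt.1 h
    exact ht ⟨by linarith [this.1], by linarith [this.2]⟩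
  have hFi : Integrable F := by
    rw [← integrableOn_iff_integrable_of_support_subset (s := Set.Icc (-1:ℝ) 1)]
    · exact hFc.continuousOn.integrableOn_compact isCompact_Icc
    · intro t ht
      by_contra h
      exact ht (hz t h)
  rw [setIntegral_eq_integral_of_forall_compl_eq_zero hz]
  set I := Set.Icc (min a b + M * ε * G) (max a b - M * ε * G) with hI
  refine le_trans ?_ (setIntegral_le_integral (s := I) hFi (Eventually.of_forall hFnn))
  have hmm : max a b - min a b = D := by rw [max_sub_min_eq_abs, hD]
  have hlen : volume.real I = D - 2 * M * ε * G := by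
    rw [hI, Real.volume_real_Icc_of_le (by linarith)]; linarith
  have key : ∫ t in I, 4 * Real.tanh M ^ 2 * (wt κ a - D / κ) ≤ ∫ t in I, F t := by
    apply setIntegral_mono_on _ hFi.integrableOn measurableSet_Icc
    · intro t ht
      have h1 := tanh_diff_aux hM hε ha hb haG hbG ht.1 ht.2
      have h2 := wt_lip hκ a t
      have h3 : |a - t| ≤ D := by
        have : 0 ≤ M * ε * G := by positivity
        have h4 := ht.1; have h5 := ht.2
        rw [abs_le]
        have m1 := min_le_left a b; have m2 := le_max_left a b
        constructor <;> linarith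
      have h4 : wt κ a - D / κ ≤ wt κ t := by
        have : 1 / κ * |a - t| ≤ D / κ := by
          rw [one_div, inv_mul_eq_div]; exact div_le_div_of_nonneg_right h3 hκ.le
        linarith
      calc 4 * Real.tanh M ^ 2 * (wt κ a - D / κ) ≤ 4 * Real.tanh M ^ 2 * wt κ t :=
            mul_le_mul_of_nonneg_left h4 (by positivity)
        _ ≤ _ := by
            rw [mul_comm]
            exact mul_le_mul_of_nonneg_left h1 (wt_nonneg _ _)
    · exact integrableOn_const (by simp [hI])
  refine le_trans ?_ key
  rw [setIntegral_const, hlen, smul_eq_mul]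
  have : (D - 2 * M * ε * G) * (4 * Real.tanh M ^ 2 * (wt κ a - D / κ)) =
    4 * Real.tanh M ^ 2 * (wt κ a * (D - 2 * M * ε * G) - D ^ 2 / κ)
     + 4 * Real.tanh M ^ 2 * (2 * M * ε * G * (D / κ)) := by
      ring
  rw [this]
  have : 0 ≤ 4 * Real.tanh M ^ 2 * (2 * M * ε * G * (D / κ)) := by positivity
  linarith

lemma taylor2 {v : R2 → ℝ} (hv : ContDiff ℝ (⊤ : ℕ∞) v) (hp : Per v) :
    ∃ C : ℝ, 0 < C ∧ ∀ x z, |v (x + z) - v x -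
      (fderiv ℝ v x (Pi.single 0 1) * z 0 + fderiv ℝ v x (Pi.single 1 1) * z 1)| ≤ C * ‖z‖ ^ 2 := by
  have h1 : ContDiff ℝ 1 (fderiv ℝ v) :=
    (hv.fderiv_right (m := (⊤ : ℕ∞)) (by simp)).of_le (by exact_mod_cast le_top)
  obtain ⟨L, hL, hb⟩ := hp.fderiv.fderiv.exists_bound (h1.continuous_fderiv (by norm_num))
  refine ⟨L, hL, fun x z => ?_⟩
  have hlip : ∀ y, ‖fderiv ℝ v y - fderiv ℝ v x‖ ≤ L * ‖y - x‖ := fun y =>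
    Convex.norm_image_sub_le_of_norm_fderiv_le (𝕜 := ℝ) (f := fderiv ℝ v) (s := Set.univ) (C := L)
    (fun x _ => (h1.differentiable (by norm_num)).differentiableAt) (fun x _ => hb x) convex_univ
    (Set.mem_univ x) (Set.mem_univ y)
  have := Convex.norm_image_sub_le_of_norm_fderiv_le' (𝕜 := ℝ) (f := v)
    (s := Metric.closedBall x ‖z‖) (C := L * ‖z‖) (φ := fderiv ℝ v x) (x := x) (y := x + z)
    (fun x _ => (hv.differentiable (by simp)).differentiableAt)
    (fun y hy => (hlip y).trans (mul_le_mul_of_nonneg_left (by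
      rw [Metric.mem_closedBall, dist_eq_norm] at hy; exact hy) hL.le))
    (convex_closedBall _ _) (Metric.mem_closedBall_self (norm_nonneg _))
    (by rw [Metric.mem_closedBall, dist_eq_norm]; simp)
  have e : fderiv ℝ v x z = fderiv ℝ v x (Pi.single 0 1) * z 0 + fderiv ℝ v x (Pi.single 1 1) * z 1 := by
    have : z = z 0 • (Pi.single 0 1 : R2) + z 1 • (Pi.single 1 1 : R2) := by
      ext i; fin_cases i <;> simp
    conv_lhs => rw [this]
    rw [map_add, map_smul, map_smul, smul_eq_mul, smul_eq_mul]; ring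
  rw [add_sub_cancel_left, e, Real.norm_eq_abs] at this
  calc _ ≤ _ := this
    _ = _ := by ring

/-- The compact annulus. -/
def annc (ε : ℝ) : Set R2 := {z | ε ≤ en2 z ∧ en2 z ≤ 1}

lemma ann_subset (ε : ℝ) : ann ε ⊆ annc ε := fun _ h => ⟨h.1.le, h.2.le⟩

lemma annc_compact (ε : ℝ) : IsCompact (annc ε) := by
  apply Metric.isCompact_of_isClosed_isBounded
  · exact (isClosed_le continuous_const en2_continuous).inter
      (isClosed_le en2_continuous continuous_const)
  · refine (Metric.isBounded_closedBall (x := (0:R2)) (r := 1)).subset fun z hz => ?_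
    rw [mem_closedBall_zero_iff]
    exact (norm_le_en2 z).trans hz.2

lemma ann_int {h : R2 → ℝ} (hc : Continuous h) {ε : ℝ} (hε : 0 < ε) :
    IntegrableOn (fun z => h z / en2 z ^ 3) (ann ε) := by
  refine IntegrableOn.mono_set (t := annc ε) ?_ (ann_subset ε)
  refine ContinuousOn.integrableOn_compact (annc_compact ε) ?_
  refine hc.continuousOn.div (en2_continuous.pow 3).continuousOn fun z hz => ?_
  exact (pow_pos (hε.trans_le hz.1) 3).ne'

lemma prod_int {h : R2 × R2 → ℝ} (hc : Continuous h) {ε : ℝ} (hε : 0 < ε) :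
    Integrable (fun p : R2 × R2 => h p / en2 p.2 ^ 3)
      ((volume.restrict cube).prod (volume.restrict (ann ε))) := by
  rw [Measure.prod_restrict]
  refine IntegrableOn.mono_set (t := Set.Icc 0 1 ×ˢ annc ε) ?_
    (Set.prod_mono cube_subset_Icc (ann_subset ε))
  refine ContinuousOn.integrableOn_compact (isCompact_Icc.prod (annc_compact ε)) ?_
  refine hc.continuousOn.div ((en2_continuous.comp continuous_snd).pow 3).continuousOn
    fun z hz => ?_
  exact (pow_pos (hε.trans_le hz.2.1) 3).ne'

lemma prod3_int {h : ℝ × (R2 × R2) → ℝ} (hc : Continuous h) {ε : ℝ} (hε : 0 < ε) :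
    Integrable (fun p : ℝ × (R2 × R2) => h p / en2 p.2.2 ^ 3)
      ((volume.restrict (Set.Icc (-1:ℝ) 1)).prod
        ((volume.restrict cube).prod (volume.restrict (ann ε)))) := by
  rw [Measure.prod_restrict, Measure.prod_restrict]
  refine IntegrableOn.mono_set (t := Set.Icc (-1:ℝ) 1 ×ˢ (Set.Icc 0 1 ×ˢ annc ε)) ?_
    (Set.prod_mono le_rfl (Set.prod_mono cube_subset_Icc (ann_subset ε)))
  refine ContinuousOn.integrableOn_compact
    (isCompact_Icc.prod (isCompact_Icc.prod (annc_compact ε))) ?_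
  refine hc.continuousOn.div ((en2_continuous.comp (continuous_snd.comp continuous_snd)).pow 3).continuousOn
    fun z hz => ?_
  exact (pow_pos (hε.trans_le hz.2.2.1) 3).ne'

def Htr (v : R2 → ℝ) (η ε t : ℝ) : ℝ :=
  ∫ x in cube, ∫ z in ann ε,
    (Real.tanh (sv v η ε t (x + z)) - Real.tanh (sv v η ε t x)) ^ 2 / en2 z ^ 3

lemma gradNorm_eq (v : R2 → ℝ) (x : R2) : gradNorm v x =
    Real.sqrt (fderiv ℝ v x (Pi.single 0 1) ^ 2 + fderiv ℝ v x (Pi.single 1 1) ^ 2) := by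
  simp [gradNorm, gradNormSq]

lemma gradNorm_continuous {v : R2 → ℝ} (hv : ContDiff ℝ (⊤ : ℕ∞) v) : Continuous (gradNorm v) :=
  Real.continuous_sqrt.comp (gradNormSq_contDiff hv).continuous

lemma avg_nonlocal {v : R2 → ℝ} (hv : ContDiff ℝ (⊤ : ℕ∞) v) (hp : Per v) {η κ M : ℝ} (hη : 0 < η)
    (hκ : 0 < κ) (hM : 0 ≤ M) : ∃ K : ℝ, ∀ ε : ℝ, 0 < ε → ε < 1 →
      IntegrableOn (fun t => wt κ t * Htr v η ε t) (Set.Icc (-1:ℝ) 1) ∧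
      4 * Real.tanh M ^ 2 * (4 * |Real.log ε| * (∫ x in cube, wt κ (v x) * gradNorm v x) - K)
        ≤ ∫ t in Set.Icc (-1:ℝ) 1, wt κ t * Htr v η ε t := by
  obtain ⟨C, hC, htay⟩ := taylor2 hv hp
  obtain ⟨L, hL, hlip⟩ := per_lip (hv.of_le (by exact_mod_cast le_top)) hp
  obtain ⟨G, hG, hgG⟩ := (gg_per hp η).exists_bound (gg_contDiff hv hη).continuous
  have hgG' : ∀ x, gg v η x ≤ G := fun x => (le_abs_self _).trans (hgG x)
  set C1 := C + L ^ 2 / κ with hC1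
  set C2 := 2 * M * G with hC2
  have hC1p : 0 ≤ C1 := by positivity
  have hC2p : 0 ≤ C2 := by positivity
  refine ⟨C1 * (2 * π) + C2 * (2 * π), fun ε hε hε1 => ?_⟩
  have hfin : IsFiniteMeasure (volume.restrict (ann ε)) := ⟨by
    rw [Measure.restrict_apply_univ]; exact volume_ann_lt_top ε⟩
  set ν := (volume.restrict cube).prod (volume.restrict (ann ε)) with hν
  set N : ℝ × (R2 × R2) → ℝ := fun p =>
    (Real.tanh (sv v η ε p.1 (p.2.1 + p.2.2)) - Real.tanh (sv v η ε p.1 p.2.1)) ^ 2 with hN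
  have hsv := sv_continuous2 hv hη hε
  have htc := contDiff_tanh'.continuous
  have hNc : Continuous N := by
    have a1 : Continuous (fun p : ℝ × (R2 × R2) => sv v η ε p.1 (p.2.1 + p.2.2)) :=
      hsv.comp (f := fun p : ℝ × (R2 × R2) => (p.1, p.2.1 + p.2.2)) (by fun_prop)
    have a2 : Continuous (fun p : ℝ × (R2 × R2) => sv v η ε p.1 p.2.1) :=
      hsv.comp (f := fun p : ℝ × (R2 × R2) => (p.1, p.2.1)) (by fun_prop)
    exact ((htc.comp a1).sub (htc.comp a2)).pow 2
  have hwc := wt_continuous κ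
  have hI3 : Integrable (fun p : ℝ × (R2 × R2) => (wt κ p.1 * N p) / en2 p.2.2 ^ 3)
      ((volume.restrict (Set.Icc (-1:ℝ) 1)).prod ν) :=
    prod3_int ((hwc.comp continuous_fst).mul hNc) hε
  have hH : ∀ t, wt κ t * Htr v η ε t = ∫ q, (wt κ t * N (t, q)) / en2 q.2 ^ 3 ∂ν := by
    intro t
    have : ∀ q : R2 × R2, (wt κ t * N (t, q)) / en2 q.2 ^ 3 = wt κ t * (N (t, q) / en2 q.2 ^ 3) :=
      fun q => by ring
    simp_rw [this]
    rw [integral_const_mul, integral_prod]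
    · rfl
    · exact prod_int (h := fun q => N (t, q)) (hNc.comp (by fun_prop)) hε
  simp_rw [hH]
  refine ⟨hI3.integral_prod_left, ?_⟩
  rw [integral_integral_swap hI3]
  set lin : R2 × R2 → ℝ := fun q => |fderiv ℝ v q.1 (Pi.single 0 1) * q.2 0 +
    fderiv ℝ v q.1 (Pi.single 1 1) * q.2 1| with hlin
  have hlinc : Continuous lin := by
    have d0 := (dv_contDiff hv (Pi.single 0 1)).continuous
    have d1 := (dv_contDiff hv (Pi.single 1 1)).continuous
    have b0 : Continuous (fun q : R2 × R2 => fderiv ℝ v q.1 (Pi.single 0 1)) := d0.comp continuous_fst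
    have b1 : Continuous (fun q : R2 × R2 => fderiv ℝ v q.1 (Pi.single 1 1)) := d1.comp continuous_fst
    simp only [hlin]
    fun_prop
  set low : R2 × R2 → ℝ := fun q =>
    (4 * Real.tanh M ^ 2 * (wt κ (v q.1) * lin q - C1 * en2 q.2 ^ 2 - C2 * ε)) / en2 q.2 ^ 3 with hlow
  have hvc := hv.continuous
  have hlowi : Integrable low ν := by
    apply prod_int _ hε
    have b2 : Continuous (fun q : R2 × R2 => wt κ (v q.1)) := hwc.comp (hvc.comp continuous_fst)
    have b3 : Continuous (fun q : R2 × R2 => en2 q.2) := en2_continuous.comp continuous_snd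
    exact continuous_const.mul (((b2.mul hlinc).sub (continuous_const.mul (b3.pow 2))).sub
      continuous_const)
  have hstep : ∫ q, low q ∂ν ≤
      ∫ q, (∫ t in Set.Icc (-1:ℝ) 1, (wt κ t * N (t, q)) / en2 q.2 ^ 3) ∂ν := by
    apply integral_mono hlowi hI3.integral_prod_right
    rintro ⟨x, z⟩
    simp only [hlow, hN]
    rw [integral_div]
    apply div_le_div_of_nonneg_right _ (pow_nonneg (en2_nonneg z) 3)
    refine le_trans ?_ (nonlocal_pt (G := G) hκ hM hε (gg_pos v hη x) (gg_pos v hη (x + z)) (hgG' x)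
      (hgG' (x + z)))
    apply mul_le_mul_of_nonneg_left _ (by positivity)
    have t1 := htay x z
    have t2 := hlip x z
    have hz := norm_le_en2 z
    have hz0 := norm_nonneg z
    set D := |v (x + z) - v x| with hD
    have hD0 : 0 ≤ D := abs_nonneg _
    have hsq : ‖z‖ ^ 2 ≤ en2 z ^ 2 := pow_le_pow_left₀ hz0 hz 2
    have t3 : lin (x, z) ≤ D + C * en2 z ^ 2 := by
      simp only [hlin]
      set l := fderiv ℝ v x (Pi.single 0 1) * z 0 + fderiv ℝ v x (Pi.single 1 1) * z 1
      have : |l| - D ≤ |v (x + z) - v x - l| := by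
        rw [abs_sub_comm]; exact abs_sub_abs_le_abs_sub _ _
      nlinarith
    have t4 : D ^ 2 / κ ≤ L ^ 2 / κ * en2 z ^ 2 := by
      rw [div_mul_eq_mul_div]
      apply div_le_div_of_nonneg_right _ hκ.le
      calc D ^ 2 ≤ (L * ‖z‖) ^ 2 := pow_le_pow_left₀ hD0 t2 2
        _ = L ^ 2 * ‖z‖ ^ 2 := by ring
        _ ≤ _ := mul_le_mul_of_nonneg_left hsq (by positivity)
    have w0 := wt_nonneg κ (v x)
    have w1 := wt_le_one κ (v x)
    have t5 : wt κ (v x) * (lin (x, z) - C * en2 z ^ 2) ≤ wt κ (v x) * D :=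
      mul_le_mul_of_nonneg_left (by linarith) w0
    have t6 : wt κ (v x) * (C * en2 z ^ 2) ≤ C * en2 z ^ 2 :=
      mul_le_of_le_one_left (by positivity) w1
    have t7 : wt κ (v x) * (2 * M * ε * G) ≤ 2 * M * ε * G :=
      mul_le_of_le_one_left (by positivity) w1
    simp only [hC1, hC2]
    nlinarith
  refine le_trans ?_ hstep
  rw [integral_prod _ hlowi]
  have hinner : ∀ x, 4 * Real.tanh M ^ 2 * (4 * |Real.log ε| * (wt κ (v x) * gradNorm v x)
      - (C1 * (2 * π) + C2 * (2 * π))) ≤ ∫ z in ann ε, low (x, z) := by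
    intro x
    have e : ∀ z, low (x, z) = 4 * Real.tanh M ^ 2 * (wt κ (v x) * (lin (x, z) / en2 z ^ 3)
      - C1 * (en2 z ^ 2 / en2 z ^ 3) - C2 * (ε / en2 z ^ 3)) := by
      intro z; simp only [hlow]; ring
    simp_rw [e]
    have i1 : IntegrableOn (fun z => lin (x, z) / en2 z ^ 3) (ann ε) :=
      ann_int (h := fun z => lin (x, z)) (hlinc.comp (by fun_prop)) hε
    have i2 : IntegrableOn (fun z => en2 z ^ 2 / en2 z ^ 3) (ann ε) :=
      ann_int (h := fun z => en2 z ^ 2) (en2_continuous.pow 2) hε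
    have i3 : IntegrableOn (fun z => ε / en2 z ^ 3) (ann ε) :=
      ann_int (h := fun z => ε) continuous_const hε
    have i12 : IntegrableOn (fun z => wt κ (v x) * (lin (x, z) / en2 z ^ 3)
        - C1 * (en2 z ^ 2 / en2 z ^ 3)) (ann ε) := (i1.const_mul _).sub (i2.const_mul _)
    rw [integral_const_mul, integral_sub i12 (i3.const_mul _),
      integral_sub (i1.const_mul _) (i2.const_mul _), integral_const_mul, integral_const_mul,
      integral_const_mul]
    apply mul_le_mul_of_nonneg_left _ (by positivity)
    have e1 := ann_lin hε hε1 (fderiv ℝ v x (Pi.single 0 1)) (fderiv ℝ v x (Pi.single 1 1))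
    rw [← gradNorm_eq] at e1
    simp only [hlin]
    rw [e1]
    have e2 := mul_le_mul_of_nonneg_left (ann_one hε hε1) hC2p
    have e3 := mul_le_mul_of_nonneg_left (ann_sq hε hε1) hC1p
    linarith
  have hgc := gradNorm_continuous hv
  have hwg : Continuous (fun x => wt κ (v x) * gradNorm v x) := (hwc.comp hvc).mul hgc
  refine le_trans (le_of_eq ?_) (integral_mono (μ := volume.restrict cube) ?_ ?_ hinner)
  · rw [integral_const_mul, integral_sub, integral_const_mul, integral_const]
    · simp
    · exact (integrable_cube hwg).const_mul _
    · exact integrable_const _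
  · exact integrable_cube (by fun_prop)
  · exact hlowi.integral_prod_left

lemma tanh_abs_le_one (s : ℝ) : |Real.tanh s| ≤ 1 := by
  rw [← sq_le_one_iff_abs_le_one]
  have := one_sub_tanh_sq s
  linarith [sech2_pos s]

lemma mlay_two (v : R2 → ℝ) (η ε t : ℝ) (x : R2) : mlay v η ε t x 2 = Real.tanh (sv v η ε t x) := by
  simp [mlay]

lemma Fen_le {v : R2 → ℝ} (hv : ContDiff ℝ (⊤ : ℕ∞) v) (hp : Per v) {η ε lam B : ℝ} (hη : 0 < η)
    (hε : 0 < ε) (hlam : 0 ≤ lam)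
    (hB : ∀ t x, ε / 2 * gradVSq (mlay v η ε t) x + (1 - (mlay v η ε t x 2) ^ 2) / (2 * ε)
        ≤ edens v η B ε t x) (t : ℝ) :
    Fen ε lam (mlay v η ε t) ≤
      (∫ x in cube, edens v η B ε t x) - lam / (4 * π * |Real.log ε|) * Htr v η ε t := by
  have hs := sv_contDiff hv hη hε t
  have h1 : (∫ x in cube, (ε / 2 * gradVSq (mlay v η ε t) x
      + (1 - (mlay v η ε t x 2) ^ 2) / (2 * ε))) ≤ ∫ x in cube, edens v η B ε t x := by
    apply integral_mono _ _ (hB t)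
    · apply integrable_cube
      simp_rw [gradVSq_mt hv hη hε t, mlay_two]
      have a1 := sech2_continuous.comp hs.continuous
      have a2 := (gradNormSq_contDiff hs).continuous
      have a3 := contDiff_tanh'.continuous.comp hs.continuous
      exact (continuous_const.mul (a1.mul a2)).add
        ((continuous_const.sub (a3.pow 2)).div_const _)
    · have hec : Continuous (fun x : R2 => edens v η B ε t x) :=
        (edens_continuous2 hv hη hε B).comp (f := fun x : R2 => (t, x)) (by fun_prop)
      exact integrable_cube hec
  have h2 := H12_lower (f := fun x => mlay v η ε t x 2)
    (by simp_rw [mlay_two]; exact (contDiff_tanh'.comp hs).of_le (by exact_mod_cast le_top))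
    (by intro x n; simp only [mlay_two]; rw [sv_per hp η ε t x n])
    (by intro x; simp only [mlay_two]; exact tanh_abs_le_one _) ε
  simp_rw [mlay_two] at h2
  unfold Fen
  have h3 := mul_le_mul_of_nonneg_left h2 (show 0 ≤ lam / |Real.log ε| by positivity)
  simp_rw [mlay_two] at h1 ⊢
  have e : lam / (4 * π * |Real.log ε|) * Htr v η ε t
    = lam / |Real.log ε| * (1 / (4 * π) * Htr v η ε t) := by
    rw [← mul_assoc]; congr 1; rw [div_mul_div_comm, mul_one]; congr 1; ring
  rw [e]
  exact sub_le_sub h1 h3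

lemma fin_pt (v : R2 → ℝ) {η : ℝ} (hη : 0 < η) (r : ℝ) (hr : 0 ≤ r) (hr1 : r ≤ 1) (κ : ℝ) (x : R2) :
    2 * wt κ (v x) * gg v η x - 2 * r * (wt κ (v x) * gradNorm v x)
      ≤ 2 * (1 - r) * gg v η x + 2 * η := by
  have g1 : gg v η x ≤ gradNorm v x + η := by
    have hs := Real.sq_sqrt (gradNormSq_nonneg v x)
    have hn : 0 ≤ Real.sqrt (gradNormSq v x) := Real.sqrt_nonneg _
    unfold gg gradNorm
    rw [Real.sqrt_le_left (by positivity)]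
    have : 0 ≤ Real.sqrt (gradNormSq v x) * η := by positivity
    linarith [add_sq (Real.sqrt (gradNormSq v x)) η]
  have w0 := wt_nonneg κ (v x)
  have w1 := wt_le_one κ (v x)
  have hg := gg_pos v hη x
  generalize wt κ (v x) = w at *
  generalize gradNorm v x = d at *
  generalize gg v η x = g at *
  have q1 : r * (g - η) ≤ r * d := mul_le_mul_of_nonneg_left (by linarith) hr
  have q5 : r * η ≤ η := mul_le_of_le_one_left hη.le hr1
  have q2 : g - r * d ≤ (1 - r) * g + η := by linarith
  have q3 : 0 ≤ (1 - r) * g + η := add_nonneg (mul_nonneg (by linarith) hg.le) hη.le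
  have q4 : w * (g - r * d) ≤ (1 - r) * g + η :=
    (mul_le_mul_of_nonneg_left q2 w0).trans (mul_le_of_le_one_left q3 w1)
  linarith

lemma core {v : R2 → ℝ} (hv : ContDiff ℝ (⊤ : ℕ∞) v) (hp : Per v) {η κ lam c : ℝ} (hη : 0 < η)
    (hκ : 0 < κ) (hκ2 : κ < 1 / 2) (hlam : 0 ≤ lam) (hlam1 : lam ≤ π / 2)
    (hc : (1 - lam / (π / 2)) * (∫ x in cube, gg v η x) + η < (1 - 2 * κ) * c) :
    ∀ᶠ ε in nhdsWithin (0:ℝ) (Set.Ioi 0), ∃ t, |t| < 1 - κ ∧ Fen ε lam (mlay v η ε t) ≤ c := by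
  have hpi := Real.pi_pos
  set μ := lam / (π / 2) with hμ
  have hμ0 : 0 ≤ μ := by positivity
  have hμ1 : μ ≤ 1 := by rw [hμ, div_le_one (by positivity)]; exact hlam1
  set A := ∫ x in cube, gg v η x with hA
  have hA0 : 0 ≤ A := integral_nonneg fun x => (gg_pos v hη x).le
  have hc0 : 0 < c := by
    have : 0 < (1 - 2 * κ) * c := by nlinarith
    exact pos_of_mul_pos_right this (by linarith)
  obtain ⟨M, hM0, hM⟩ : ∃ M : ℝ, 0 ≤ M ∧
      (1 - μ * Real.tanh M ^ 2) * A + η < (1 - 2 * κ) * c := by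
    have h1 : Tendsto (fun M => (1 - μ * Real.tanh M ^ 2) * A + η) atTop
        (nhds ((1 - μ * 1 ^ 2) * A + η)) :=
      ((tendsto_const_nhds.sub ((tanh_tendsto_atTop.pow 2).const_mul μ)).mul_const A).add_const η
    rw [one_pow, mul_one] at h1
    obtain ⟨M, h2, h3⟩ := ((h1.eventually_lt_const hc).and (eventually_ge_atTop 0)).exists
    exact ⟨M, h3, h2⟩
  set T := Real.tanh M ^ 2 with hT
  have hT0 : 0 ≤ T := sq_nonneg _
  have hT1 : T ≤ 1 := by
    have := one_sub_tanh_sq M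
    linarith [sech2_pos M]
  have hμT : μ * T ≤ 1 := mul_le_one₀ hμ1 hT0 hT1
  obtain ⟨B, hB0, hB⟩ := local_bound hv hp hη
  obtain ⟨K1, hK1⟩ := avg_local hv hp hη hκ hB0
  obtain ⟨K2, hK2⟩ := avg_nonlocal hv hp hη hκ hM0
  set W := ∫ x in cube, wt κ (v x) * gradNorm v x with hW
  set δ := 2 * ((1 - 2 * κ) * c - ((1 - μ * T) * A + η)) with hδ
  have hδ0 : 0 < δ := by rw [hδ]; linarith
  have hlim : Tendsto (fun ε : ℝ => ε * K1 + lam / (4 * π * |Real.log ε|) * (4 * T * K2))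
      (nhdsWithin (0:ℝ) (Set.Ioi 0)) (nhds 0) := by
    have l1 : Tendsto (fun ε : ℝ => ε * K1) (nhdsWithin (0:ℝ) (Set.Ioi 0)) (nhds (0 * K1)) :=
      (tendsto_id.mono_left nhdsWithin_le_nhds).mul_const K1
    have l2 : Tendsto (fun ε : ℝ => 4 * π * |Real.log ε|) (nhdsWithin (0:ℝ) (Set.Ioi 0)) atTop :=
      (tendsto_abs_atBot_atTop.comp Real.tendsto_log_nhdsGT_zero).const_mul_atTop (by positivity)
    have l3 := (l2.const_div_atTop lam).mul_const (4 * T * K2)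
    simpa using l1.add l3
  filter_upwards [hlim.eventually_lt_const hδ0, self_mem_nhdsWithin,
    Ioo_mem_nhdsGT (zero_lt_one (α := ℝ))] with ε h1 hε hε1
  have hε : 0 < ε := hε
  have hε1 : ε < 1 := hε1.2
  by_contra hcon
  push Not at hcon
  obtain ⟨hi2, hk2⟩ := hK2 ε hε hε1
  have hk1 := hK1 ε hε hε1.le
  have hlog : 0 < |Real.log ε| := abs_pos.2 (Real.log_neg hε hε1).ne
  set a := lam / (4 * π * |Real.log ε|) with ha
  have ha0 : 0 ≤ a := by positivity
  have hwc := wt_continuous κ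
  have hi1 : IntegrableOn (fun t => wt κ t * ∫ x in cube, edens v η B ε t x) (Set.Icc (-1:ℝ) 1) := by
    have := (integrable_prod_cube ((hwc.comp continuous_fst).mul
      (edens_continuous2 hv hη hε B)) (-1) 1).integral_prod_left
    refine this.congr (Eventually.of_forall fun t => ?_)
    exact integral_const_mul (wt κ t) _
  have hi0 : IntegrableOn (fun t => wt κ t) (Set.Icc (-1:ℝ) 1) :=
    hwc.continuousOn.integrableOn_compact isCompact_Icc
  have hpt : ∀ t, c * wt κ t ≤ wt κ t * (∫ x in cube, edens v η B ε t x)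
      - a * (wt κ t * Htr v η ε t) := by
    intro t
    by_cases ht : |t| < 1 - κ
    · have f1 := hcon t ht
      have f2 := Fen_le hv hp hη hε hlam (B := B) (hB ε hε) t
      have := mul_le_mul_of_nonneg_left (f1.le.trans f2) (wt_nonneg κ t)
      linarith
    · rw [wt_zero hκ (not_lt.1 ht)]; simp
  have hinteg : c * (∫ t in Set.Icc (-1:ℝ) 1, wt κ t) ≤
      (∫ t in Set.Icc (-1:ℝ) 1, wt κ t * ∫ x in cube, edens v η B ε t x)
      - a * ∫ t in Set.Icc (-1:ℝ) 1, wt κ t * Htr v η ε t := by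
    rw [← integral_const_mul, ← integral_const_mul, ← integral_sub hi1 (hi2.const_mul a)]
    exact integral_mono (hi0.const_mul c) (hi1.sub (hi2.const_mul a)) hpt
  have hw := mul_le_mul_of_nonneg_left (wt_integral hκ hκ2) hc0.le
  have hk2' := mul_le_mul_of_nonneg_left hk2 ha0
  have hal : a * (4 * T * (4 * |Real.log ε| * W - K2)) = 2 * (μ * T * W) - a * (4 * T * K2) := by
    rw [ha, hμ]; field_simp; ring
  have hvc := hv.continuous
  have hgc := gradNorm_continuous hv
  have hggc := (gg_contDiff hv hη).continuous
  have hwv : Continuous (fun x => wt κ (v x)) := hwc.comp hvc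
  have hfin : (∫ x in cube, 2 * wt κ (v x) * gg v η x) - 2 * (μ * T * W)
      ≤ 2 * ((1 - μ * T) * A + η) := by
    have e1 : (∫ x in cube, 2 * wt κ (v x) * gg v η x) - 2 * (μ * T * W)
        = ∫ x in cube, (2 * wt κ (v x) * gg v η x - 2 * (μ * T) * (wt κ (v x) * gradNorm v x)) := by
      rw [integral_sub (integrable_cube (by fun_prop)) (integrable_cube (by fun_prop)),
        integral_const_mul (2 * (μ * T))]
      ring
    have e2 : 2 * ((1 - μ * T) * A + η) = ∫ x in cube, (2 * (1 - μ * T) * gg v η x + 2 * η) := by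
      rw [integral_add (integrable_cube (by fun_prop)) (integrable_const _), integral_const_mul,
        integral_const]
      simp; ring
    rw [e1, e2]
    apply integral_mono (integrable_cube (by fun_prop)) (integrable_cube (by fun_prop))
    intro x
    simp only
    exact fin_pt v hη (μ * T) (by positivity) hμT κ x
  rw [hal] at hk2'
  linarith

lemma en3_nonneg (w : R3) : 0 ≤ en3 w := Real.sqrt_nonneg _

lemma en3_continuous : Continuous en3 := by unfold en3; fun_prop

lemma en3_mlay (v : R2 → ℝ) (η ε t : ℝ) (x : R2) {u : ℝ} (hu : u ^ 2 = 1) :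
    en3 (mlay v η ε t x - u • e3) = Real.sqrt (2 * (1 - u * Real.tanh (sv v η ε t x))) := by
  unfold en3
  congr 1
  have := sech_sq_add (sv v η ε t x)
  simp only [Fin.sum_univ_three, mlay, e3, Pi.sub_apply, Pi.smul_apply, smul_eq_mul,
    Matrix.cons_val_zero, Matrix.cons_val_one, Matrix.cons_val]
  ring_nf at this ⊢
  linarith

lemma l1_pt {v : R2 → ℝ} {η ε κ t u G : ℝ} (hη : 0 < η) (hε : 0 < ε) (hκ : 0 < κ)
    (ht : |t| < 1 - κ) (hu : u = 1 ∨ u = -1) (x : R2) (hG : gg v η x ≤ G) :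
    en3 (mlay v η ε t x - u • e3)
      ≤ 4 / κ * |v x - u| + Real.sqrt (2 * (1 - Real.tanh (κ / (2 * G) / ε))) := by
  have hu2 : u ^ 2 = 1 := by rcases hu with rfl | rfl <;> norm_num
  have hg := gg_pos v hη x
  have hG0 : 0 < G := hg.trans_le hG
  rw [en3_mlay v η ε t x hu2]
  have hT := abs_le.1 (tanh_abs_le_one (sv v η ε t x))
  rcases le_or_gt (κ / 2) |v x - u| with h | h
  · have h1 : Real.sqrt (2 * (1 - u * Real.tanh (sv v η ε t x))) ≤ 2 := by
      rw [Real.sqrt_le_left (by norm_num)]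
      rcases hu with rfl | rfl <;> linarith [hT.1, hT.2]
    have h2 : 2 ≤ 4 / κ * |v x - u| := by
      rw [div_mul_eq_mul_div, le_div_iff₀ hκ]; linarith
    linarith [Real.sqrt_nonneg (2 * (1 - Real.tanh (κ / (2 * G) / ε)))]
  · have h3 : Real.tanh (κ / (2 * G) / ε) ≤ u * Real.tanh (sv v η ε t x) := by
      have e : u * Real.tanh (sv v η ε t x) = Real.tanh (u * sv v η ε t x) := by
        rcases hu with rfl | rfl <;> simp
      rw [e]
      apply tanh_mono'
      have h4 : κ / 2 ≤ u * (v x - t) := by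
        have a := abs_lt.1 h; have b := abs_lt.1 ht
        rcases hu with rfl | rfl <;> linarith [a.1, a.2, b.1, b.2]
      unfold sv
      rw [mul_div_assoc', div_div, div_le_div_iff₀ (by positivity) (by positivity)]
      have h5 : κ * (ε * gg v η x) ≤ κ * (ε * G) := by gcongr
      have h6 : κ * (ε * G) ≤ u * (v x - t) * (2 * G * ε) := by
        have := mul_le_mul_of_nonneg_right h4 (show 0 ≤ 2 * G * ε by positivity)
        linarith
      linarith
    have : Real.sqrt (2 * (1 - u * Real.tanh (sv v η ε t x)))
        ≤ Real.sqrt (2 * (1 - Real.tanh (κ / (2 * G) / ε))) := Real.sqrt_le_sqrt (by linarith)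
    have : 0 ≤ 4 / κ * |v x - u| := by positivity
    linarith

lemma q_tendsto {d : ℝ} (hd : 0 < d) :
    Tendsto (fun ε : ℝ => Real.sqrt (2 * (1 - Real.tanh (d / ε)))) (nhdsWithin (0:ℝ) (Set.Ioi 0))
      (nhds 0) := by
  have h1 : Tendsto (fun ε : ℝ => d / ε) (nhdsWithin (0:ℝ) (Set.Ioi 0)) atTop := by
    simp_rw [div_eq_mul_inv]
    exact tendsto_inv_nhdsGT_zero.const_mul_atTop hd
  have h2 := ((tendsto_const_nhds (x := (1:ℝ))).sub (tanh_tendsto_atTop.comp h1)).const_mul 2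
  have h3 := (Real.continuous_sqrt.tendsto _).comp h2
  rw [sub_self, mul_zero, Real.sqrt_zero] at h3
  exact h3

/-- Clipped periodic extension of the third component. -/
def ut (m : R2 → R3) (x : R2) : ℝ := max (-1) (min 1 (m (fr x) 2))

lemma ut_meas {m : R2 → R3} (hm : Measurable m) : Measurable (ut m) := by
  have h : Measurable (fun x => m (fr x) 2) :=
    (measurable_pi_apply 2).comp (hm.comp measurable_fr)
  exact measurable_const.max (measurable_const.min h)

lemma ut_per (m : R2 → R3) : Per (ut m) := by
  intro x n
  unfold ut
  rw [fr_per x n]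

lemma ut_abs (m : R2 → R3) (x : R2) : |ut m x| ≤ 1 := by
  rw [abs_le]
  exact ⟨le_max_left _ _, max_le (by norm_num) (min_le_left _ _)⟩

lemma ut_pm {m : R2 → R3} (h : ∀ᵐ x ∂(volume.restrict cube), m x = e3 ∨ m x = -e3) :
    ∀ᵐ x ∂(volume.restrict cube), (ut m x = 1 ∨ ut m x = -1) ∧ m x = ut m x • e3
      ∧ m x 2 = ut m x := by
  filter_upwards [h, ae_restrict_mem measurableSet_cube] with x hx hxc
  unfold ut
  rw [fr_of_mem hxc]
  rcases hx with hx | hx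
  · have : m x 2 = 1 := by rw [hx]; simp [e3]
    rw [this]; simp [hx]
  · have : m x 2 = -1 := by rw [hx]; simp [e3]
    rw [this]; simp [hx]

lemma TVset_ut {m : R2 → R3} (h : ∀ᵐ x ∂(volume.restrict cube), m x = e3 ∨ m x = -e3) :
    TVset (ut m) = TVset (fun x => m x 2) := by
  have e : ∀ φ : R2 → R2, ∫ x in cube, ut m x * ∑ i, fderiv ℝ φ x (Pi.single i 1) i
      = ∫ x in cube, m x 2 * ∑ i, fderiv ℝ φ x (Pi.single i 1) i := by
    intro φ
    apply integral_congr_ae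
    filter_upwards [ut_pm h] with x hx
    rw [hx.2.2]
  unfold TVset
  simp_rw [e]

lemma moll_L1 {u : R2 → ℝ} (hm : Measurable u) {C : ℝ} (hC : ∀ x, |u x| ≤ C) :
    Tendsto (fun n => ∫ x in cube, |moll n u x - u x|) atTop (nhds 0) := by
  have h := tendsto_integral_of_dominated_convergence (μ := volume.restrict cube)
    (F := fun n x => |moll n u x - u x|) (f := fun _ => 0) (fun _ => 2 * C)
    (fun n => (((moll_contDiff n hm hC).continuous.measurable.sub hm).norm).aestronglyMeasurable)
    (integrable_const _)
    (fun n => Eventually.of_forall fun x => by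
      rw [Real.norm_eq_abs, abs_abs]
      calc |moll n u x - u x| ≤ |moll n u x| + |u x| := abs_sub _ _
        _ ≤ 2 * C := by linarith [moll_bound n hC x, hC x])
    (by
      refine ae_restrict_of_ae ?_
      filter_upwards [moll_tendsto hm hC] with x hx
      have := (hx.sub_const (u x)).abs
      simpa using this)
  simpa using h

lemma recov {m : R2 → R3} (hm : Measurable m)
    (hpm : ∀ᵐ x ∂(volume.restrict cube), m x = e3 ∨ m x = -e3) {lam c0 : ℝ}
    (hlam : 0 ≤ lam) (hlam1 : lam ≤ π / 2)
    (H : ∀ δ : ℝ, 0 < δ → ∃ η : ℝ, 0 < η ∧ ∃ κ : ℝ, 0 < κ ∧ κ < 1 / 2 ∧ ∀ n : ℕ,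
      (1 - lam / (π / 2)) * (∫ x in cube, gg (moll n (ut m)) η x) + η < (1 - 2 * κ) * (c0 + δ))
    {δ : ℝ} (hδ : 0 < δ) :
    ∀ᶠ ε in nhdsWithin (0:ℝ) (Set.Ioi 0), ∃ m' : R2 → R3, Mag m' ∧
      (∫ x in cube, en3 (m' x - m x)) ≤ δ ∧ Fen ε lam m' ≤ c0 + δ := by
  obtain ⟨η, hη, κ, hκ, hκ2, hn⟩ := H δ hδ
  have hum := ut_meas hm
  have hub := ut_abs m
  have hL := (moll_L1 hum hub).const_mul (4 / κ)
  rw [mul_zero] at hL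
  obtain ⟨n, hLn⟩ := (hL.eventually_lt_const (half_pos hδ)).exists
  set v := moll n (ut m) with hv
  have hvs : ContDiff ℝ (⊤ : ℕ∞) v := moll_contDiff n hum hub
  have hvp : Per v := moll_per n (ut_per m)
  obtain ⟨G, hG, hgG⟩ := (gg_per hvp η).exists_bound (gg_contDiff hvs hη).continuous
  have hq := q_tendsto (show 0 < κ / (2 * G) by positivity)
  filter_upwards [core hvs hvp hη hκ hκ2 hlam hlam1 (hn n), self_mem_nhdsWithin,
    hq.eventually_lt_const (half_pos hδ)] with ε h1 hε hqε
  have hε : 0 < ε := hε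
  obtain ⟨t, ht, hF⟩ := h1
  refine ⟨mlay v η ε t, mt_mag hvs hvp hη hε t, ?_, hF⟩
  set Q := Real.sqrt (2 * (1 - Real.tanh (κ / (2 * G) / ε))) with hQ
  have hvi : Integrable (fun x => |v x - ut m x|) (volume.restrict cube) := by
    refine Integrable.mono' (integrable_const (2:ℝ))
      ((hvs.continuous.measurable.sub hum).norm).aestronglyMeasurable
      (Eventually.of_forall fun x => ?_)
    rw [Real.norm_eq_abs, abs_abs]
    calc |v x - ut m x| ≤ |v x| + |ut m x| := abs_sub _ _
        _ ≤ 2 := by linarith [moll_bound n hub x, hub x]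
  calc (∫ x in cube, en3 (mlay v η ε t x - m x))
      ≤ ∫ x in cube, (4 / κ * |v x - ut m x| + Q) := by
        apply integral_mono_of_nonneg (Eventually.of_forall fun x => en3_nonneg _)
          ((hvi.const_mul _).add (integrable_const _))
        filter_upwards [ut_pm hpm] with x hx
        rw [hx.2.1]
        exact l1_pt hη hε hκ ht hx.1 x ((le_abs_self _).trans (hgG x))
    _ = 4 / κ * (∫ x in cube, |v x - ut m x|) + Q := by
        rw [integral_add (hvi.const_mul _) (integrable_const _), integral_const_mul, integral_const]
        simp
    _ ≤ δ := by linarith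

/-- spherical coordinates -/
def sph (θ φ : ℝ) : R3 :=
  ![Real.sin θ * Real.cos φ, Real.sin θ * Real.sin φ, Real.cos θ]

lemma sph_sq (θ φ : ℝ) : ∑ i, (sph θ φ i) ^ 2 = 1 := by
  simp only [Fin.sum_univ_three, sph, Matrix.cons_val_zero, Matrix.cons_val_one, Matrix.cons_val]
  have h1 := Real.sin_sq_add_cos_sq θ
  have h2 := Real.sin_sq_add_cos_sq φ
  calc _ = Real.sin θ ^ 2 * (Real.sin φ ^ 2 + Real.cos φ ^ 2) + Real.cos θ ^ 2 := by ring
    _ = 1 := by rw [h2, mul_one, h1]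

lemma sph_contDiff : ContDiff ℝ 1 (fun p : ℝ × ℝ => sph p.1 p.2) := by
  rw [contDiff_pi]
  intro i
  fin_cases i
  · simp only [sph, Fin.zero_eta, Matrix.cons_val_zero]
    exact (Real.contDiff_sin.comp contDiff_fst).mul (Real.contDiff_cos.comp contDiff_snd)
  · simp only [sph, Fin.mk_one, Matrix.cons_val_one]
    exact (Real.contDiff_sin.comp contDiff_fst).mul (Real.contDiff_sin.comp contDiff_snd)
  · simp only [sph, Fin.reduceFinMk, Matrix.cons_val]
    exact Real.contDiff_cos.comp contDiff_fst

lemma sph_polar {w : R3} (hw : ∑ i, (w i) ^ 2 = 1) :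
    sph (Real.arccos (w 2)) (Complex.arg ⟨w 0, w 1⟩) = w := by
  rw [Fin.sum_univ_three] at hw
  have h2 : |w 2| ≤ 1 := by
    rw [← sq_le_one_iff_abs_le_one]; nlinarith [sq_nonneg (w 0), sq_nonneg (w 1)]
  have hn : ‖(⟨w 0, w 1⟩ : ℂ)‖ = Real.sin (Real.arccos (w 2)) := by
    rw [Real.sin_arccos, Complex.norm_def, Complex.normSq_apply]
    congr 1
    simp only
    linarith [sq (w 0), sq (w 1)]
  ext i
  fin_cases i
  · simp only [sph, Fin.zero_eta, Matrix.cons_val_zero]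
    rw [← hn, Complex.norm_mul_cos_arg]
  · simp only [sph, Fin.mk_one, Matrix.cons_val_one]
    rw [← hn, Complex.norm_mul_sin_arg]
    rfl
  · simp only [sph, Fin.reduceFinMk, Matrix.cons_val]
    exact Real.cos_arccos (abs_le.1 h2).1 (abs_le.1 h2).2

lemma en3_sub_le {a b : R3} (ha : ∑ i, (a i) ^ 2 = 1) (hb : ∑ i, (b i) ^ 2 = 1) :
    en3 (a - b) ≤ 2 := by
  unfold en3
  rw [Real.sqrt_le_left (by norm_num)]
  rw [Fin.sum_univ_three] at *
  simp only [Pi.sub_apply]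
  nlinarith [sq_nonneg (a 0 + b 0), sq_nonneg (a 1 + b 1), sq_nonneg (a 2 + b 2)]

lemma conv_aux {a b : ℕ → ℝ} {θ φ : ℝ} {w : R3} (h1 : Tendsto a atTop (nhds θ))
    (h2 : Tendsto b atTop (nhds φ)) (e : sph θ φ = w) :
    Tendsto (fun k => en3 (sph (a k) (b k) - w)) atTop (nhds 0) := by
  have h5 : Tendsto (fun k => sph (a k) (b k)) atTop (nhds w) := by
    have hc : Continuous (fun p : ℝ × ℝ => sph p.1 p.2) := sph_contDiff.continuous
    have h3 : Tendsto (fun p : ℝ × ℝ => sph p.1 p.2) (nhds (θ, φ)) (nhds w) := by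
      have := hc.tendsto (θ, φ)
      dsimp only at this
      rwa [e] at this
    exact Tendsto.comp (g := fun p : ℝ × ℝ => sph p.1 p.2) (f := fun k => (a k, b k)) h3
      (h1.prodMk_nhds h2)
  have h6 : Tendsto (fun k => en3 (sph (a k) (b k) - w)) atTop (nhds (en3 (w - w))) :=
    (en3_continuous.tendsto _).comp (h5.sub_const w)
  have h7 : en3 (w - w) = 0 := by simp [en3]
  rwa [h7] at h6

lemma fallback {m : R2 → R3} (hm : Measurable m)
    (hsph : ∀ᵐ x ∂(volume.restrict cube), ∑ i, (m x i) ^ 2 = 1) :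
    ∃ mk : ℕ → R2 → R3, (∀ k, Mag (mk k)) ∧
      Tendsto (fun k => ∫ x in cube, en3 (mk k x - m x)) atTop (nhds 0) := by
  set θ : R2 → ℝ := fun x => Real.arccos (m (fr x) 2) with hθ
  set φ : R2 → ℝ := fun x => Complex.arg ⟨m (fr x) 0, m (fr x) 1⟩ with hφ
  have hmf : Measurable (fun x => m (fr x)) := hm.comp measurable_fr
  have hmi : ∀ i, Measurable (fun x => m (fr x) i) := fun i => (measurable_pi_apply i).comp hmf
  have hθm : Measurable θ := Real.continuous_arccos.measurable.comp (hmi 2)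
  have hφm : Measurable φ := by
    refine Complex.measurable_arg.comp ?_
    exact Complex.measurableEquivRealProd.symm.measurable.comp ((hmi 0).prodMk (hmi 1))
  have hθb : ∀ x, |θ x| ≤ π := fun x => by
    rw [abs_of_nonneg (Real.arccos_nonneg _)]; exact Real.arccos_le_pi _
  have hφb : ∀ x, |φ x| ≤ π := fun x => Complex.abs_arg_le_pi _
  have hθp : Per θ := fun x n => by simp only [hθ]; rw [fr_per x n]
  have hφp : Per φ := fun x n => by simp only [hφ]; rw [fr_per x n]
  have hcd : ∀ k, ContDiff ℝ 1 (fun x => sph (moll k θ x) (moll k φ x)) := fun k =>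
    sph_contDiff.comp (f := fun x => (moll k θ x, moll k φ x)) (((moll_contDiff k hθm hθb).of_le (by exact_mod_cast le_top)).prodMk
      ((moll_contDiff k hφm hφb).of_le (by exact_mod_cast le_top)))
  refine ⟨fun k x => sph (moll k θ x) (moll k φ x), fun k => ⟨hcd k, ?_, fun x => sph_sq _ _⟩, ?_⟩
  · intro x n
    simp only
    rw [moll_per k hθp x n, moll_per k hφp x n]
  · have h := tendsto_integral_of_dominated_convergence (μ := volume.restrict cube)
      (F := fun k x => en3 (sph (moll k θ x) (moll k φ x) - m x)) (f := fun _ => 0) (fun _ => 2)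
      (fun k => (en3_continuous.measurable.comp
        ((hcd k).continuous.measurable.sub hm)).aestronglyMeasurable)
      (integrable_const _)
      (fun k => by
        filter_upwards [hsph] with x hx
        rw [Real.norm_of_nonneg (en3_nonneg _)]
        exact en3_sub_le (sph_sq _ _) hx)
      (by
        filter_upwards [ae_restrict_of_ae (moll_tendsto hθm hθb),
          ae_restrict_of_ae (moll_tendsto hφm hφb), hsph,
          ae_restrict_mem measurableSet_cube] with x h1 h2 h3 h4
        have e : sph (θ x) (φ x) = m x := by
          simp only [hθ, hφ]
          rw [fr_of_mem h4]
          exact sph_polar h3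
        exact conv_aux h1 h2 e)
    simpa using h

lemma diag {P : ℕ → ℕ → Prop} (hP : ∀ n, ∀ᶠ k in atTop, P n k) :
    ∃ N : ℕ → ℕ, Tendsto N atTop atTop ∧ ∀ᶠ k in atTop, P (N k) k := by
  classical
  refine ⟨fun k => Nat.findGreatest (fun n => P n k) k, ?_, ?_⟩
  · rw [tendsto_atTop]
    intro n
    filter_upwards [hP n, eventually_ge_atTop n] with k h1 h2
    exact Nat.le_findGreatest h2 h1
  · filter_upwards [hP 0] with k h1
    exact Nat.findGreatest_spec (P := fun n => P n k) (Nat.zero_le k) h1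

lemma mag_const : Mag (fun _ => e3) :=
  ⟨contDiff_const, fun _ _ => rfl, fun _ => by simp [Fin.sum_univ_three, e3]⟩

lemma diag_main {m : R2 → R3} {lam c0 : ℝ} {ε : ℕ → ℝ}
    (hε : ∀ k, 0 < ε k ∧ ε k < 1) (hε0 : Tendsto ε atTop (nhds 0))
    (R : ∀ δ : ℝ, 0 < δ → ∀ᶠ e in nhdsWithin (0:ℝ) (Set.Ioi 0), ∃ m' : R2 → R3, Mag m' ∧
      (∫ x in cube, en3 (m' x - m x)) ≤ δ ∧ Fen e lam m' ≤ c0 + δ) :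
    ∃ mk : ℕ → R2 → R3, (∀ k, Mag (mk k)) ∧
      Tendsto (fun k => ∫ x in cube, en3 (mk k x - m x)) atTop (nhds 0) ∧
      ∀ c : ℝ, c0 < c → ∀ᶠ k in atTop, Fen (ε k) lam (mk k) ≤ c := by
  have hw : Tendsto ε atTop (nhdsWithin (0:ℝ) (Set.Ioi 0)) :=
    tendsto_nhdsWithin_iff.2 ⟨hε0, Eventually.of_forall fun k => (hε k).1⟩
  obtain ⟨N, hN, hP⟩ := diag (P := fun n k => ∃ m' : R2 → R3, Mag m' ∧
      (∫ x in cube, en3 (m' x - m x)) ≤ 1 / ((n:ℝ) + 1) ∧ Fen (ε k) lam m' ≤ c0 + 1 / ((n:ℝ) + 1))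
      (fun n => hw.eventually (R (1 / ((n:ℝ) + 1)) Nat.one_div_pos_of_nat))
  have hd : Tendsto (fun k => 1 / ((N k : ℝ) + 1)) atTop (nhds 0) :=
    (tendsto_one_div_add_atTop_nhds_zero_nat (𝕜 := ℝ)).comp hN
  have hex : ∀ k, ∃ m' : R2 → R3, Mag m' ∧ ((∃ m' : R2 → R3, Mag m' ∧
      (∫ x in cube, en3 (m' x - m x)) ≤ 1 / ((N k:ℝ) + 1) ∧
        Fen (ε k) lam m' ≤ c0 + 1 / ((N k:ℝ) + 1)) →
      (∫ x in cube, en3 (m' x - m x)) ≤ 1 / ((N k:ℝ) + 1) ∧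
        Fen (ε k) lam m' ≤ c0 + 1 / ((N k:ℝ) + 1)) := by
    intro k
    by_cases h : ∃ m' : R2 → R3, Mag m' ∧
      (∫ x in cube, en3 (m' x - m x)) ≤ 1 / ((N k:ℝ) + 1) ∧
        Fen (ε k) lam m' ≤ c0 + 1 / ((N k:ℝ) + 1)
    · obtain ⟨m', h1, h2⟩ := h
      exact ⟨m', h1, fun _ => h2⟩
    · exact ⟨_, mag_const, fun h' => absurd h' h⟩
  choose mk hmag hmk using hex
  refine ⟨mk, hmag, ?_, ?_⟩
  · refine tendsto_of_tendsto_of_tendsto_of_le_of_le' tendsto_const_nhds hd ?_ ?_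
    · exact Eventually.of_forall fun k => integral_nonneg fun x => en3_nonneg _
    · filter_upwards [hP] with k hk
      exact (hmk k hk).1
  · intro c hc
    filter_upwards [hP, hd.eventually_lt_const (sub_pos.2 hc)] with k hk h2
    have := (hmk k hk).2
    linarith

lemma kappa_choice {c0 δ X : ℝ} (hδ : 0 < δ) (hX : X ≤ c0 + δ / 2) :
    X < (1 - 2 * (δ / (8 * (|c0| + δ)))) * (c0 + δ) := by
  have h1 := le_abs_self c0
  have h0 := abs_nonneg c0
  have h2 : δ / (8 * (|c0| + δ)) * (c0 + δ) ≤ δ / 8 := by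
    rw [div_mul_eq_mul_div, div_le_div_iff₀ (by positivity) (by norm_num)]
    nlinarith
  nlinarith

lemma kappa_lt {c0 δ : ℝ} (hδ : 0 < δ) : δ / (8 * (|c0| + δ)) < 1 / 2 := by
  have h0 := abs_nonneg c0
  rw [div_lt_div_iff₀ (by positivity) (by norm_num)]
  linarith

theorem main_thm (lam : ℝ) (hlam0 : 0 ≤ lam) (hlam : lam ≤ π / 2)
    (m : R2 → R3) (hmeas : Measurable m)
    (hsph : ∀ᵐ x ∂(volume.restrict cube), ∑ i, (m x i) ^ 2 = 1)
    (ε : ℕ → ℝ) (hε : ∀ k, 0 < ε k ∧ ε k < 1) (hε0 : Tendsto ε atTop (nhds 0)) :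
    ∃ mk : ℕ → R2 → R3, (∀ k, Mag (mk k)) ∧
      Tendsto (fun k => ∫ x in cube, en3 (mk k x - m x)) atTop (nhds 0) ∧
      (lam < π / 2 → IsBVpm m →
        ∀ c : ℝ, (1 - lam / (π / 2)) * TV (fun x => m x 2) < c →
          ∀ᶠ k in atTop, Fen (ε k) lam (mk k) ≤ c) ∧
      (lam = π / 2 → (∀ᵐ x ∂(volume.restrict cube), m x = e3 ∨ m x = -e3) →
        ∀ c : ℝ, 0 < c → ∀ᶠ k in atTop, Fen (ε k) lam (mk k) ≤ c) := by
  have hpi := Real.pi_pos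
  by_cases h1 : lam < π / 2 ∧ IsBVpm m
  · obtain ⟨hlt, hpm, hbd⟩ := h1
    have hTV : TV (ut m) = TV (fun x => m x 2) := by unfold TV; rw [TVset_ut hpm]
    have hbd' : BddAbove (TVset (ut m)) := by rw [TVset_ut hpm]; exact hbd
    have hμ0 : 0 ≤ lam / (π / 2) := by positivity
    have hμ1 : lam / (π / 2) < 1 := by rw [div_lt_one (by positivity)]; exact hlt
    set c0 := (1 - lam / (π / 2)) * TV (fun x => m x 2) with hc0
    have R := fun δ (hδ : 0 < δ) => recov hmeas hpm (c0 := c0) hlam0 hlam (fun δ hδ => by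
      refine ⟨δ / 4, by positivity, δ / (8 * (|c0| + δ)), by positivity, kappa_lt hδ, fun n => ?_⟩
      apply kappa_choice hδ
      have h2 := tv_bound n (ut_meas hmeas) (ut_per m) (ut_abs m) hbd'
        (show 0 < δ / 4 by positivity)
      rw [hTV] at h2
      have h3 := mul_le_mul_of_nonneg_left h2 (sub_nonneg.2 hμ1.le)
      have h4 : lam / (π / 2) * (δ / 4) ≥ 0 := by positivity
      rw [hc0]
      linarith) (δ := δ) hδ
    obtain ⟨mk, a, b, c⟩ := diag_main hε hε0 R
    exact ⟨mk, a, b, fun _ _ => c, fun h => absurd h hlt.ne⟩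
  by_cases h2 : lam = π / 2 ∧ ∀ᵐ x ∂(volume.restrict cube), m x = e3 ∨ m x = -e3
  · obtain ⟨heq, hpm⟩ := h2
    have hμ1 : lam / (π / 2) = 1 := by rw [heq, div_self (by positivity)]
    have R := fun δ (hδ : 0 < δ) => recov hmeas hpm (c0 := 0) hlam0 hlam (fun δ hδ => by
      refine ⟨δ / 4, by positivity, δ / (8 * (|0| + δ)), by positivity, kappa_lt hδ, fun n => ?_⟩
      apply kappa_choice hδ
      rw [hμ1]
      linarith) (δ := δ) hδ
    obtain ⟨mk, a, b, c⟩ := diag_main hε hε0 R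
    exact ⟨mk, a, b, fun h => absurd heq h.ne, fun _ _ => c⟩
  · obtain ⟨mk, a, b⟩ := fallback hmeas hsph
    exact ⟨mk, a, b, fun h h' => absurd ⟨h, h'⟩ h1, fun h h' => absurd ⟨h, h'⟩ h2⟩

end Aux

/-- Lemma `le:constr`, recovery sequence: for `λ ≤ λ_c` and any
`m ∈ L¹(𝕋²;S²)` there is a sequence `m_k ∈ H¹(𝕋²;S²)` converging to `m` in `L¹` with
`limsup F_{ε_k,λ}[m_k] ≤ F_{*,λ}[m]`. -/
theorem stmt_12 (lam : ℝ) (hlam0 : 0 ≤ lam) (hlam : lam ≤ π / 2)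
    (m : R2 → R3) (hmeas : Measurable m)
    (hsph : ∀ᵐ x ∂(volume.restrict cube), ∑ i, (m x i) ^ 2 = 1)
    (ε : ℕ → ℝ) (hε : ∀ k, 0 < ε k ∧ ε k < 1) (hε0 : Tendsto ε atTop (nhds 0)) :
    ∃ mk : ℕ → R2 → R3, (∀ k, Mag (mk k)) ∧
      Tendsto (fun k => ∫ x in cube, en3 (mk k x - m x)) atTop (nhds 0) ∧
      (lam < π / 2 → IsBVpm m →
        ∀ c : ℝ, (1 - lam / (π / 2)) * TV (fun x => m x 2) < c →
          ∀ᶠ k in atTop, Fen (ε k) lam (mk k) ≤ c) ∧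
      (lam = π / 2 → (∀ᵐ x ∂(volume.restrict cube), m x = e3 ∨ m x = -e3) →
        ∀ c : ℝ, 0 < c → ∀ᶠ k in atTop, Fen (ε k) lam (mk k) ≤ c) := by
  exact main_thm lam hlam0 hlam m hmeas hsph ε hε hε0
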